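/- arXiv:1508.05599 — 3 statements merged into one kernel-verified Lean document; each statement's English description precedes it below -/
import Mathlib

section
/- Let Y be a locally contractible paracompact Hausdorff space and let (V_α)_{α∈A} be a locally finite indexed open covering of Y that is closed under finite nonempty intersections (whenever V_α ∩ V_β ≠ ∅ there is γ ∈ A with V_γ = V_α ∩ V_β), and suppose every V_α is contractible. Let 𝔙 be the small category with object set A having exactly one morphism α → β whenever V_α ⊆ V_β and none otherwise. Then Y is homotopy equivalent to the classifying space |B𝔙|. -/
open CategoryTheory

/-- The category `𝔙` associated to an indexed open covering `V : A → Set Y`: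
objects are the indices and there is exactly one morphism `α → β` when `V α ⊆ V β`. -/
def coverCategory {Y : Type} (V : A → Set Y) : Category A where
  Hom α β := PLift (V α ⊆ V β)
  id _ := ⟨subset_rfl⟩
  comp f g := ⟨f.down.trans g.down⟩
  id_comp f := by cases f; rfl
  comp_id f := by cases f; rfl
  assoc f g h := by cases f; cases g; cases h; rfl

namespace NerveTheorem
open Opposite
open scoped NNReal Topology

/-- The point of the realization of `X` with barycentric coordinates `t` in the simplex `x`. -/
noncomputable def realizationPoint {X : SSet.{0}} {n : SimplexCategory} (x : X.obj (op n))
    (t : stdSimplex ℝ (Fin (n.len + 1))) : SSet.toTop.obj X :=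
  TopCat.toSSetObjEquiv _ (op n) ((sSetTopAdj.unit.app X).app (op n) x) t

lemma continuous_realizationPoint {X : SSet.{0}} {n : SimplexCategory} (x : X.obj (op n)) :
    Continuous (realizationPoint x) :=
  (TopCat.toSSetObjEquiv _ (op n) ((sSetTopAdj.unit.app X).app (op n) x)).continuous

lemma realizationPoint_map {X : SSet.{0}} {m n : SimplexCategory} (f : m ⟶ n)
    (x : X.obj (op n)) (t : stdSimplex ℝ (Fin (m.len + 1))) :
    realizationPoint (X.map f.op x) t = realizationPoint x (stdSimplex.map f t) := by
  have := congr_arg (fun s => TopCat.toSSetObjEquiv _ (op m) s t)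
    (ConcreteCategory.congr_hom ((sSetTopAdj.unit.app X).naturality f.op) x)
  exact this

lemma toTop_map_realizationPoint {X X' : SSet.{0}} (F : X ⟶ X') {n : SimplexCategory}
    (x : X.obj (op n)) (t : stdSimplex ℝ (Fin (n.len + 1))) :
    SSet.toTop.map F (realizationPoint x t) = realizationPoint (F.app (op n) x) t := by
  have h := ConcreteCategory.congr_hom
    (NatTrans.congr_app (sSetTopAdj.unit.naturality F) (op n)) x
  have := congr_arg (fun s => TopCat.toSSetObjEquiv _ (op n) s t) h
  exact this.symm

lemma realization_hom_ext {X : SSet.{0}} {Z : Type} [TopologicalSpace Z]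
    {f g : C(SSet.toTop.obj X, Z)}
    (h : ∀ (n : SimplexCategory) (x : X.obj (op n)) (t : stdSimplex ℝ (Fin (n.len + 1))),
      f (realizationPoint x t) = g (realizationPoint x t)) : f = g := by
  have : TopCat.ofHom f = (TopCat.ofHom g : SSet.toTop.obj X ⟶ TopCat.of Z) := by
    apply (sSetTopAdj.homEquiv _ _).injective
    ext n x
    apply (TopCat.toSSetObjEquiv _ n).injective
    ext t
    exact h n.unop x t
  exact congr_arg TopCat.Hom.hom this

lemma exists_realization_desc {X : SSet.{0}} {Z : Type} [TopologicalSpace Z]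
    (φ : ∀ (n : SimplexCategory) (_ : X.obj (op n)), C(stdSimplex ℝ (Fin (n.len + 1)), Z))
    (hφ : ∀ (m n : SimplexCategory) (f : m ⟶ n) (x : X.obj (op n))
      (t : stdSimplex ℝ (Fin (m.len + 1))),
      φ m (X.map f.op x) t = φ n x (stdSimplex.map f t)) :
    ∃ F : C(SSet.toTop.obj X, Z), ∀ (n : SimplexCategory) (x : X.obj (op n))
      (t : stdSimplex ℝ (Fin (n.len + 1))), F (realizationPoint x t) = φ n x t := by
  let G : X ⟶ TopCat.toSSet.obj (TopCat.of Z) :=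
    { app n := TypeCat.ofHom fun x => (TopCat.toSSetObjEquiv (TopCat.of Z) n).symm (φ n.unop x)
      naturality m n f := by
        ext x
        apply (TopCat.toSSetObjEquiv _ n).injective
        ext t
        exact hφ n.unop m.unop f.unop x t }
  refine ⟨((sSetTopAdj.homEquiv _ _).symm G).hom, fun n x t => ?_⟩
  have h : sSetTopAdj.homEquiv _ _ ((sSetTopAdj.homEquiv _ _).symm G) = G := by simp
  have h2 := ConcreteCategory.congr_hom (NatTrans.congr_app h (op n)) x
  have h3 := congr_arg (fun s => TopCat.toSSetObjEquiv _ (op n) s t) h2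
  exact h3

section Simplex
variable {ι κ : Type} [Fintype ι] [Fintype κ]

/-- Barycentric coordinates as a finitely supported function. -/
noncomputable def simplexWeight (t : stdSimplex ℝ ι) : ι →₀ ℝ≥0 :=
  Finsupp.equivFunOnFinite.symm fun i => (t i).toNNReal

@[simp] lemma simplexWeight_apply (t : stdSimplex ℝ ι) (i : ι) :
    simplexWeight t i = (t i).toNNReal := rfl

lemma degree_simplexWeight (t : stdSimplex ℝ ι) : (simplexWeight t).degree = 1 := by
  rw [Finsupp.degree_eq_sum]
  simp only [simplexWeight_apply]
  refine (Real.toNNReal_sum_of_nonneg fun i _ => t.2.1 i).symm.trans ?_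
  simpa using congr_arg Real.toNNReal t.2.2

lemma simplexWeight_injective : Function.Injective (simplexWeight : stdSimplex ℝ ι → ι →₀ ℝ≥0) := by
  intro s t h
  ext i
  have := DFunLike.congr_fun h i
  simp only [simplexWeight_apply] at this
  exact (Real.toNNReal_eq_toNNReal_iff (s.2.1 i) (t.2.1 i)).1 this

lemma exists_simplexWeight_eq (w : ι →₀ ℝ≥0) (hw : w.degree = 1) :
    ∃ t : stdSimplex ℝ ι, simplexWeight t = w := by
  rw [Finsupp.degree_eq_sum] at hw
  refine ⟨⟨fun i => w i, fun i => (w i).2, (NNReal.coe_sum _ _).symm.trans (congr_arg _ hw)⟩, ?_⟩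
  ext i
  exact congr_arg _ (Real.toNNReal_coe (r := w i))

lemma mapDomain_apply_eq_sum {P : Type} [DecidableEq P] (f : ι → P) (w : ι →₀ ℝ≥0) (p : P) :
    Finsupp.mapDomain f w p = ∑ i with f i = p, w i := by
  rw [Finsupp.mapDomain, Finsupp.sum_fintype _ _ (by simp), Finsupp.finsetSum_apply,
    Finset.sum_filter]
  exact Finset.sum_congr rfl fun i _ => by rw [Finsupp.single_apply]

lemma simplexWeight_map (f : ι → κ) (t : stdSimplex ℝ ι) :
    simplexWeight (stdSimplex.map f t) = Finsupp.mapDomain f (simplexWeight t) := by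
  classical
  ext1 k
  rw [simplexWeight_apply, stdSimplex.map_coe, FunOnFinite.linearMap_apply_apply,
    mapDomain_apply_eq_sum]
  exact Real.toNNReal_sum_of_nonneg fun i _ => t.2.1 i

lemma continuous_simplexWeight (i : ι) : Continuous fun t : stdSimplex ℝ ι => simplexWeight t i :=
  continuous_real_toNNReal.comp ((continuous_apply i).comp continuous_subtype_val)

end Simplex

section Nerve
variable {P : Type} [PartialOrder P]

/-- The simplex of the nerve of an ordered set given by a monotone sequence. -/
noncomputable def chainSimplex {n : SimplexCategory} (σ : Fin (n.len + 1) →o P) :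
    (nerve P).obj (op n) :=
  σ.monotone.functor

lemma chainSimplex_comp {m n : SimplexCategory} (θ : Fin (m.len + 1) →o Fin (n.len + 1))
    (σ : Fin (n.len + 1) →o P) :
    chainSimplex (σ.comp θ) =
      (nerve P).map (show m ⟶ n from SimplexCategory.Hom.mk θ).op (chainSimplex σ) :=
  CategoryTheory.Functor.ext (fun _ => rfl) fun _ _ _ => Subsingleton.elim _ _

/-- The monotone sequence of vertices of a simplex of the nerve of an ordered set. -/
def simplexChain {n : SimplexCategory} (x : (nerve P).obj (op n)) : Fin (n.len + 1) →o P :=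
  ⟨fun i => CategoryTheory.Functor.obj (C := Fin (n.len + 1)) (D := P) x i,
    CategoryTheory.Functor.monotone (X := Fin (n.len + 1)) (Y := P) x⟩

@[simp] lemma simplexChain_chainSimplex {n : SimplexCategory} (σ : Fin (n.len + 1) →o P) :
    simplexChain (chainSimplex σ) = σ := rfl

@[simp] lemma chainSimplex_simplexChain {n : SimplexCategory} (x : (nerve P).obj (op n)) :
    chainSimplex (simplexChain x) = x :=
  CategoryTheory.Functor.ext (fun _ => rfl) fun _ _ _ => Subsingleton.elim _ _

/-- A finite subset of an ordered set which is a chain is enumerated by an order embedding. -/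
lemma exists_chain_enumeration (S : Finset P) (hS : IsChain (· ≤ ·) (S : Set P))
    (hne : S.Nonempty) :
    ∃ (n : SimplexCategory) (e : Fin (n.len + 1) ↪o P), Set.range e = S := by
  classical
  let _ : LinearOrder (S : Set P) := hS.linearOrder
  have hc : Fintype.card (S : Set P) = S.card - 1 + 1 := by
    have := hne.card_pos
    simp only [Finset.coe_sort_coe, Fintype.card_coe]
    omega
  let e := monoEquivOfFin (S : Set P) hc
  refine ⟨SimplexCategory.mk (S.card - 1), e.toOrderEmbedding.trans (OrderEmbedding.subtype _), ?_⟩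
  ext p
  constructor
  · rintro ⟨i, rfl⟩
    exact (e i).2
  · intro hp
    exact ⟨e.symm ⟨p, hp⟩, by simp⟩

lemma exists_factorization {m n : ℕ} (e : Fin n ↪o P) (σ : Fin m →o P)
    (h : Set.range σ ⊆ Set.range e) : ∃ θ : Fin m →o Fin n, σ = e.toOrderHom.comp θ := by
  choose θ hθ using fun i => h ⟨i, rfl⟩
  refine ⟨⟨θ, fun i j hij => e.le_iff_le.1 ?_⟩, ?_⟩
  · rw [hθ, hθ]
    exact σ.monotone hij
  · ext i
    exact (hθ i).symm

lemma realizationPoint_chainSimplex_eq {n k : SimplexCategory} (σ : Fin (n.len + 1) →o P)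
    (τ : Fin (k.len + 1) →o P) (t : stdSimplex ℝ (Fin (n.len + 1)))
    (u : stdSimplex ℝ (Fin (k.len + 1)))
    (h : Finsupp.mapDomain σ (simplexWeight t) = Finsupp.mapDomain τ (simplexWeight u))
    (hr : Set.range τ ⊆ Set.range σ) :
    realizationPoint (chainSimplex σ) t = realizationPoint (chainSimplex τ) u := by
  classical
  obtain ⟨m, e, he⟩ := exists_chain_enumeration (Finset.univ.image σ)
    (by simpa using σ.monotone.isChain_range) (by simp)
  have he' : Set.range e = Set.range σ := by simpa using he
  obtain ⟨θ, rfl⟩ := exists_factorization e σ he'.ge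
  obtain ⟨ι, rfl⟩ := exists_factorization e τ (hr.trans he'.ge)
  rw [chainSimplex_comp, chainSimplex_comp, realizationPoint_map, realizationPoint_map]
  congr 1
  apply simplexWeight_injective
  apply Finsupp.mapDomain_injective e.injective
  have h1 := simplexWeight_map θ t
  have h2 := simplexWeight_map ι u
  refine (congr_arg _ h1).trans (Eq.trans ?_ (congr_arg _ h2).symm)
  rw [← Finsupp.mapDomain_comp, ← Finsupp.mapDomain_comp]
  exact h

end Nerve

/-- Points of the order complex of `P`: finitely supported weights of total mass one
whose support is a chain. -/
@[ext] structure ChainWeight (P : Type) [PartialOrder P] where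
  /-- the underlying weight function -/
  weight : P →₀ ℝ≥0
  degree_eq : weight.degree = 1
  isChain : IsChain (· ≤ ·) (weight.support : Set P)

namespace ChainWeight
variable {P P' : Type} [PartialOrder P] [PartialOrder P']

/-- The point with given barycentric coordinates in the simplex spanned by a monotone sequence. -/
noncomputable def ofSimplex {n : ℕ} (σ : Fin (n + 1) →o P) (t : stdSimplex ℝ (Fin (n + 1))) :
    ChainWeight P where
  weight := Finsupp.mapDomain σ (simplexWeight t)
  degree_eq := by rw [Finsupp.degree_mapDomain, degree_simplexWeight]
  isChain := by
    classical
    refine σ.monotone.isChain_range.mono fun p hp => ?_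
    obtain ⟨i, -, hi⟩ := Finset.mem_image.1 (Finsupp.mapDomain_support hp)
    exact ⟨i, hi⟩

noncomputable instance : TopologicalSpace (ChainWeight P) :=
  ⨆ (n : ℕ) (σ : Fin (n + 1) →o P), TopologicalSpace.coinduced (ofSimplex σ) inferInstance

lemma continuous_iff {Z : Type} [TopologicalSpace Z] {f : ChainWeight P → Z} :
    Continuous f ↔ ∀ (n : ℕ) (σ : Fin (n + 1) →o P), Continuous fun t => f (ofSimplex σ t) := by
  simp only [continuous_iSup_dom, continuous_coinduced_dom]
  rfl

lemma continuous_ofSimplex {n : ℕ} (σ : Fin (n + 1) →o P) : Continuous (ofSimplex σ) :=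
  continuous_iff.1 continuous_id n σ

lemma support_nonempty (w : ChainWeight P) : w.weight.support.Nonempty := by
  rw [Finsupp.support_nonempty_iff]
  intro h
  simpa [h] using w.degree_eq

lemma ofSimplex_map {m n : ℕ} (θ : Fin (m + 1) →o Fin (n + 1)) (σ : Fin (n + 1) →o P)
    (t : stdSimplex ℝ (Fin (m + 1))) :
    ofSimplex σ (stdSimplex.map θ t) = ofSimplex (σ.comp θ) t := by
  ext1
  simp only [ofSimplex]
  rw [simplexWeight_map, ← Finsupp.mapDomain_comp]
  rfl

lemma exists_ofSimplex_eq (w : ChainWeight P) (e : Fin (n + 1) ↪o P)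
    (he : (w.weight.support : Set P) ⊆ Set.range e) :
    ∃ t, ofSimplex e.toOrderHom t = w := by
  obtain ⟨t, ht⟩ := exists_simplexWeight_eq
    (Finsupp.comapDomain e w.weight e.injective.injOn) (by
      rw [← Finsupp.degree_mapDomain e, Finsupp.mapDomain_comapDomain _ e.injective _ he]
      exact w.degree_eq)
  refine ⟨t, ?_⟩
  ext1
  simp only [ofSimplex, ht]
  exact Finsupp.mapDomain_comapDomain _ e.injective _ he

/-- An enumeration of the support. -/
lemma exists_enumeration (w : ChainWeight P) :
    ∃ (n : SimplexCategory) (e : Fin (n.len + 1) ↪o P) (t : stdSimplex ℝ (Fin (n.len + 1))),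
      Set.range e = w.weight.support ∧ ofSimplex e.toOrderHom t = w := by
  obtain ⟨n, e, he⟩ := exists_chain_enumeration w.weight.support w.isChain w.support_nonempty
  obtain ⟨t, ht⟩ := exists_ofSimplex_eq w e he.ge
  exact ⟨n, e, t, he, ht⟩

/-- Pushforward of chain weights along a monotone map. -/
noncomputable def map (f : P →o P') (w : ChainWeight P) : ChainWeight P' where
  weight := Finsupp.mapDomain f w.weight
  degree_eq := by rw [Finsupp.degree_mapDomain, w.degree_eq]
  isChain := by
    classical
    refine (w.isChain.image_of_map_rel _ _ f fun _ _ h => f.monotone h).mono fun p hp => ?_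
    simpa using Finsupp.mapDomain_support hp

lemma map_ofSimplex (f : P →o P') {n : ℕ} (σ : Fin (n + 1) →o P)
    (t : stdSimplex ℝ (Fin (n + 1))) : map f (ofSimplex σ t) = ofSimplex (f.comp σ) t := by
  ext1
  simp only [map, ofSimplex]
  rw [← Finsupp.mapDomain_comp]
  rfl

/-- The point of the realization of the nerve determined by a chain weight. -/
noncomputable def toRealization (w : ChainWeight P) : SSet.toTop.obj (nerve P) :=
  realizationPoint (chainSimplex (w.exists_enumeration.choose_spec.choose).toOrderHom)
    w.exists_enumeration.choose_spec.choose_spec.choose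

lemma toRealization_ofSimplex {n : SimplexCategory} (σ : Fin (n.len + 1) →o P)
    (t : stdSimplex ℝ (Fin (n.len + 1))) :
    toRealization (ofSimplex σ t) = realizationPoint (chainSimplex σ) t := by
  classical
  obtain ⟨h1, h2⟩ := (ofSimplex σ t).exists_enumeration.choose_spec.choose_spec.choose_spec
  refine (realizationPoint_chainSimplex_eq _ _ _ _ (congr_arg weight h2).symm ?_).symm
  refine h1.le.trans fun p hp => ?_
  obtain ⟨i, -, hi⟩ := Finset.mem_image.1 (Finsupp.mapDomain_support hp)
  exact ⟨i, hi⟩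

lemma continuous_toRealization : Continuous (toRealization (P := P)) := by
  rw [continuous_iff]
  intro n σ
  refine (continuous_realizationPoint
    (chainSimplex (n := SimplexCategory.mk n) σ)).congr fun t => ?_
  exact (toRealization_ofSimplex (n := SimplexCategory.mk n) σ t).symm

lemma exists_ofRealization : ∃ F : C(SSet.toTop.obj (nerve P), ChainWeight P),
    ∀ (n : SimplexCategory) (x : (nerve P).obj (op n)) (t : stdSimplex ℝ (Fin (n.len + 1))),
      F (realizationPoint x t) = ofSimplex (simplexChain x) t :=
  exists_realization_desc (fun _ x => ⟨ofSimplex (simplexChain x), continuous_ofSimplex _⟩)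
    fun _ _ f x t => (ofSimplex_map f.toOrderHom (simplexChain x) t).symm

/-- The realization of the nerve of an ordered set is the space of chain weights. -/
noncomputable def realizationHomeomorph (P : Type) [PartialOrder P] :
    SSet.toTop.obj (nerve P) ≃ₜ ChainWeight P where
  toFun := exists_ofRealization.choose
  invFun := toRealization
  left_inv := by
    let G : C(SSet.toTop.obj (nerve P), SSet.toTop.obj (nerve P)) :=
      (⟨toRealization, continuous_toRealization⟩ : C(_, _)).comp exists_ofRealization.choose
    have : G = ContinuousMap.id _ := realization_hom_ext fun n x t => by
      change toRealization (exists_ofRealization.choose (realizationPoint x t)) = _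
      rw [exists_ofRealization.choose_spec, toRealization_ofSimplex, chainSimplex_simplexChain]
      rfl
    exact fun z => DFunLike.congr_fun this z
  right_inv w := by
    obtain ⟨n, e, t, -, rfl⟩ := w.exists_enumeration
    rw [toRealization_ofSimplex, exists_ofRealization.choose_spec]
    rfl
  continuous_toFun := exists_ofRealization.choose.continuous
  continuous_invFun := continuous_toRealization

lemma realizationHomeomorph_symm_ofSimplex {n : SimplexCategory} (σ : Fin (n.len + 1) →o P)
    (t : stdSimplex ℝ (Fin (n.len + 1))) :
    (realizationHomeomorph P).symm (ofSimplex σ t) = realizationPoint (chainSimplex σ) t :=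
  toRealization_ofSimplex σ t

end ChainWeight

section LocFinCont
variable {P Z Z' : Type} [TopologicalSpace Z] [TopologicalSpace Z']

/-- A family of finitely supported weights which is locally supported in a finite set and
depends continuously on the parameter. -/
structure LocFinCont (ψ : Z → P →₀ ℝ≥0) : Prop where
  locFin : ∀ z₀, ∃ F : Finset P, ∀ᶠ z in 𝓝 z₀, (ψ z).support ⊆ F
  cont : ∀ p, Continuous fun z => ψ z p

namespace LocFinCont
variable {ψ ψ' : Z → P →₀ ℝ≥0}

lemma comp (h : LocFinCont ψ) {g : Z' → Z} (hg : Continuous g) : LocFinCont fun z => ψ (g z) where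
  locFin z := by
    obtain ⟨F, hF⟩ := h.locFin (g z)
    exact ⟨F, hg.continuousAt.eventually hF⟩
  cont p := (h.cont p).comp hg

lemma transform (h : LocFinCont ψ)
    (hfin : ∀ F : Finset P, ∃ F' : Finset P, ∀ z, (ψ z).support ⊆ F → (ψ' z).support ⊆ F')
    (hcont : ∀ (F : Finset P) (p : P), ∃ c : Z → ℝ≥0, Continuous c ∧
      ∀ z, (ψ z).support ⊆ F → ψ' z p = c z) : LocFinCont ψ' where
  locFin z := by
    obtain ⟨F, hF⟩ := h.locFin z
    obtain ⟨F', hF'⟩ := hfin F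
    exact ⟨F', hF.mono hF'⟩
  cont p := by
    rw [continuous_iff_continuousAt]
    intro z
    obtain ⟨F, hF⟩ := h.locFin z
    obtain ⟨c, hc, hcF⟩ := hcont F p
    exact hc.continuousAt.congr (hF.mono fun z hz => (hcF z hz).symm)

lemma smul (h : LocFinCont ψ) {c : Z → ℝ≥0} (hc : Continuous c) :
    LocFinCont fun z => c z • ψ z :=
  h.transform (fun F => ⟨F, fun _ hz => Finsupp.support_smul.trans hz⟩)
    fun _ p => ⟨_, hc.mul (h.cont p), fun _ _ => rfl⟩

lemma add (h : LocFinCont ψ) (h' : LocFinCont ψ') : LocFinCont fun z => ψ z + ψ' z where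
  locFin z := by
    classical
    obtain ⟨F, hF⟩ := h.locFin z
    obtain ⟨F', hF'⟩ := h'.locFin z
    refine ⟨F ∪ F', ?_⟩
    filter_upwards [hF, hF'] with z hz hz'
    exact Finsupp.support_add.trans (Finset.union_subset_union hz hz')
  cont p := (h.cont p).add (h'.cont p)

lemma continuous_degree (h : LocFinCont ψ) : Continuous fun z => (ψ z).degree := by
  rw [continuous_iff_continuousAt]
  intro z
  obtain ⟨F, hF⟩ := h.locFin z
  refine (continuous_finsetSum F fun p _ => h.cont p).continuousAt.congr (hF.mono fun z hz => ?_)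
  exact (Finset.sum_subset hz fun p _ hp => Finsupp.notMem_support_iff.1 hp).symm

lemma isClosed_support_subset (h : LocFinCont ψ) (S : Set P) :
    IsClosed {z | ((ψ z).support : Set P) ⊆ S} := by
  have : {z | ((ψ z).support : Set P) ⊆ S} = ⋂ p ∈ Sᶜ, {z | ψ z p = 0} := by
    ext z
    simp only [Set.mem_ofPred_eq, Set.mem_iInter, Set.mem_compl_iff]
    refine forall_congr' fun p => ?_
    rw [Finset.mem_coe, Finsupp.mem_support_iff, not_imp_comm]
  rw [this]
  exact isClosed_biInter fun p _ => isClosed_eq (h.cont p) continuous_const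

/-- Continuity may be checked on the closed pieces where the support lies in a given chain. -/
lemma continuous_of_pieces [PartialOrder P] (h : LocFinCont ψ)
    (hchain : ∀ z, IsChain (· ≤ ·) ((ψ z).support : Set P)) {E : Type} [TopologicalSpace E]
    {f : Z → E} (hf : ∀ S : Finset P, IsChain (· ≤ ·) (S : Set P) →
      ContinuousOn f {z | ((ψ z).support : Set P) ⊆ S}) : Continuous f := by
  classical
  rw [continuous_iff_continuousAt]
  intro z₀
  obtain ⟨F, hF⟩ := h.locFin z₀
  let T : Set (Finset P) := {S | S ⊆ F ∧ IsChain (· ≤ ·) (S : Set P)}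
  have hT : T.Finite := F.powerset.finite_toSet.subset fun S hS => Finset.mem_powerset.2 hS.1
  have hU : (⋃ S ∈ T, {z | ((ψ z).support : Set P) ⊆ S}) ∈ 𝓝 z₀ := by
    filter_upwards [hF] with z hz
    exact Set.mem_biUnion (show (ψ z).support ∈ T from ⟨hz, hchain z⟩)
      (show ((ψ z).support : Set P) ⊆ (ψ z).support from subset_rfl)
  refine ContinuousWithinAt.continuousAt ?_ hU
  rw [ContinuousWithinAt, nhdsWithin_biUnion hT]
  refine Filter.tendsto_iSup.2 fun S => Filter.tendsto_iSup.2 fun hS => ?_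
  by_cases hz : z₀ ∈ {z | ((ψ z).support : Set P) ⊆ S}
  · exact hf S hS.2 z₀ hz
  · have := (h.isClosed_support_subset S).isOpen_compl.mem_nhds hz
    rw [nhdsWithin, Filter.inf_principal_eq_bot.2 this]
    exact Filter.tendsto_bot

end LocFinCont
end LocFinCont

namespace ChainWeight
variable {P Z : Type} [PartialOrder P] [TopologicalSpace Z]

lemma locFinCont_ofSimplex {n : ℕ} (σ : Fin (n + 1) →o P) :
    LocFinCont fun t => (ofSimplex σ t).weight where
  locFin t := by
    classical
    exact ⟨Finset.univ.image σ, .of_forall fun t => Finsupp.mapDomain_support.trans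
      (Finset.image_subset_image (Finset.subset_univ _))⟩
  cont p := by
    classical
    simp only [ofSimplex, mapDomain_apply_eq_sum]
    exact continuous_finsetSum _ fun i _ => continuous_simplexWeight i

lemma continuous_of_weight {f : Z → ChainWeight P} (h : LocFinCont fun z => (f z).weight) :
    Continuous f := by
  refine h.continuous_of_pieces (fun z => (f z).isChain) fun S hS => ?_
  rcases S.eq_empty_or_nonempty with rfl | hne
  · convert continuousOn_empty f
    ext z
    simpa using (f z).support_nonempty.ne_empty
  obtain ⟨n, e, he⟩ := exists_chain_enumeration S hS hne
  rw [continuousOn_iff_continuous_domRestrict]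
  choose t ht using fun z : {z | ((f z).weight.support : Set P) ⊆ S} =>
    exists_ofSimplex_eq (f z) e (z.2.trans he.ge)
  have : Continuous t := by
    refine Continuous.subtype_mk (continuous_pi fun i => ?_) _
    have : ∀ z, t z i = (f z).weight (e i) := fun z => by
      have h2 := DFunLike.congr_fun (congr_arg weight (ht z)) (e i)
      have h3 : (ofSimplex e.toOrderHom (t z)).weight (e i) = simplexWeight (t z) i :=
        Finsupp.mapDomain_apply e.injective _ _
      rw [← h2, h3, simplexWeight_apply]
      exact (Real.coe_toNNReal _ ((t z).2.1 i)).symm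
    refine Continuous.congr ?_ fun z => (this z).symm
    exact NNReal.continuous_coe.comp ((h.cont (e i)).comp continuous_subtype_val)
  exact ((continuous_ofSimplex e.toOrderHom).comp this).congr ht

/-- Rescale a nonzero weight function to total mass one. -/
noncomputable def normalize (w : P →₀ ℝ≥0) (hw : w ≠ 0)
    (hc : IsChain (· ≤ ·) (w.support : Set P)) : ChainWeight P where
  weight := w.degree⁻¹ • w
  degree_eq := by
    have : w.degree ≠ 0 := by rwa [Ne, Finsupp.degree_eq_zero_iff]
    rw [← inv_mul_cancel₀ this, Finsupp.degree_apply, Finsupp.degree_apply, Finset.mul_sum]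
    exact Finset.sum_subset Finsupp.support_smul fun p _ hp => Finsupp.notMem_support_iff.1 hp
  isChain := hc.mono Finsupp.support_smul

lemma normalize_eq {w : P →₀ ℝ≥0} {hw : w ≠ 0} {hc : IsChain (· ≤ ·) (w.support : Set P)}
    {v : ChainWeight P} (h : w = v.weight) : normalize w hw hc = v := by
  ext1
  simp [normalize, h, v.degree_eq]

lemma normalize_congr {w w' : P →₀ ℝ≥0} {hw : w ≠ 0} {hc : IsChain (· ≤ ·) (w.support : Set P)}
    {hw' : w' ≠ 0} {hc' : IsChain (· ≤ ·) (w'.support : Set P)} (h : w = w') :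
    normalize w hw hc = normalize w' hw' hc' := by
  subst h
  rfl

lemma locFinCont_normalize {ψ : Z → P →₀ ℝ≥0} (h : LocFinCont ψ) (hne : ∀ z, ψ z ≠ 0)
    (hc : ∀ z, IsChain (· ≤ ·) ((ψ z).support : Set P)) :
    LocFinCont fun z => (normalize (ψ z) (hne z) (hc z)).weight :=
  h.smul (h.continuous_degree.inv₀ fun z => by
    rw [Ne, Finsupp.degree_eq_zero_iff]
    exact hne z)

lemma continuous_normalize {ψ : Z → P →₀ ℝ≥0} (h : LocFinCont ψ) (hne : ∀ z, ψ z ≠ 0)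
    (hc : ∀ z, IsChain (· ≤ ·) ((ψ z).support : Set P)) :
    Continuous fun z => normalize (ψ z) (hne z) (hc z) :=
  continuous_of_weight (locFinCont_normalize h hne hc)

lemma continuous_of_ofSimplex_prod {Z : Type} [TopologicalSpace Z]
    {H : ChainWeight P × unitInterval → Z}
    (h : ∀ (n : ℕ) (σ : Fin (n + 1) →o P),
      Continuous fun p : stdSimplex ℝ (Fin (n + 1)) × unitInterval => H (ofSimplex σ p.1, p.2)) :
    Continuous H := by
  have h1 (w : ChainWeight P) : Continuous fun τ => H (w, τ) := by
    obtain ⟨n, e, t, -, ht⟩ := w.exists_enumeration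
    have := (h n.len e.toOrderHom).comp (Continuous.prodMk_right t)
    simpa only [Function.comp_def, ht] using this
  have h2 : Continuous fun w => (⟨fun τ => H (w, τ), h1 w⟩ : C(unitInterval, Z)) := by
    rw [continuous_iff]
    intro n σ
    exact (ContinuousMap.curry ⟨_, h n σ⟩).continuous
  exact ContinuousMap.continuous_uncurry_of_continuous ⟨_, h2⟩

end ChainWeight

section Telescope
variable {ι κ : Type} [LinearOrder ι] [Fintype ι] [LinearOrder κ] [Fintype κ]

/-- Increment at `i` of a function of the cumulative weights. -/
noncomputable def increment (t : ι → ℝ≥0) (g : ℝ≥0 → ℝ≥0) (i : ι) : ℝ≥0 :=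
  g (∑ j with j ≤ i, t j) - g (∑ j with j < i, t j)

lemma sum_increment_add {g : ℝ≥0 → ℝ≥0} (hg : Monotone g) (t : ι → ℝ≥0) (L : Finset ι) :
    (∀ i ∈ L, ∀ j ≤ i, j ∈ L) → ∑ i ∈ L, increment t g i + g 0 = g (∑ i ∈ L, t i) := by
  induction L using Finset.induction_on_max with
  | empty => simp
  | insert a s hs ih =>
    intro hL
    have ha : a ∉ s := fun h => (hs a h).false
    have h1 : s = Finset.univ.filter (· < a) := by
      ext j
      simp only [Finset.mem_filter_univ]
      refine ⟨hs j, fun hj => ?_⟩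
      exact (Finset.mem_insert.1 (hL a (Finset.mem_insert_self _ _) j hj.le)).resolve_left hj.ne
    have h2 : insert a s = Finset.univ.filter (· ≤ a) := by
      ext j
      rw [Finset.mem_insert, h1]
      simp [le_iff_eq_or_lt]
    have h3 := ih fun i hi j hj => by
      rw [h1, Finset.mem_filter_univ] at hi ⊢
      exact hj.trans_lt hi
    rw [Finset.sum_insert ha, add_assoc, h3]
    rw [increment, ← h1, ← h2]
    exact tsub_add_cancel_of_le
      (hg (Finset.sum_le_sum_of_subset (Finset.subset_insert _ _)))

lemma increment_map {g : ℝ≥0 → ℝ≥0} (hg : Monotone g) (t : ι → ℝ≥0) (θ : ι → κ)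
    (hθ : Monotone θ) (k : κ) :
    increment (fun k => ∑ i with θ i = k, t i) g k = ∑ i with θ i = k, increment t g i := by
  have h1 := sum_increment_add hg t (Finset.univ.filter fun i => θ i ≤ k) (by
    simp only [Finset.mem_filter_univ]
    exact fun i hi j hj => (hθ hj).trans hi)
  have h2 := sum_increment_add hg t (Finset.univ.filter fun i => θ i < k) (by
    simp only [Finset.mem_filter_univ]
    exact fun i hi j hj => (hθ hj).trans_lt hi)
  have h3 (p : κ → Prop) [DecidablePred p] :
      ∑ l with p l, ∑ i with θ i = l, t i = ∑ i with p (θ i), t i := by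
    rw [Finset.sum_fiberwise_eq_sum_filter]
    simp
  rw [increment, h3, h3, ← h1, ← h2, add_tsub_add_eq_tsub_right]
  have h4 : Finset.univ.filter (fun i => θ i ≤ k) =
      (Finset.univ.filter fun i => θ i = k) ∪ Finset.univ.filter fun i => θ i < k := by
    ext i
    simp [le_iff_eq_or_lt]
  rw [h4, Finset.sum_union, add_tsub_cancel_right]
  rw [Finset.disjoint_filter]
  exact fun i _ h => h.not_lt

lemma sum_le_eq_add (t : ι → ℝ≥0) (i : ι) :
    ∑ j with j ≤ i, t j = t i + ∑ j with j < i, t j := by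
  rw [← Finset.sum_insert (by simp)]
  congr 1
  ext j
  simp [le_iff_eq_or_lt]

end Telescope

/-- The product of a finite ordinal with the two-element chain. -/
@[ext] structure Prism (n : ℕ) where
  /-- the position in the ordinal -/
  base : Fin (n + 1)
  /-- the end of the prism -/
  height : Fin 2

namespace Prism

/-- A prism is a product of two chains. -/
def equivProd (n : ℕ) : Fin (n + 1) × Fin 2 ≃ Prism n where
  toFun p := ⟨p.1, p.2⟩
  invFun p := (p.base, p.height)
  left_inv _ := rfl
  right_inv _ := rfl

instance (n : ℕ) : PartialOrder (Prism n) := PartialOrder.lift _ (equivProd n).symm.injective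
instance (n : ℕ) : Fintype (Prism n) := Fintype.ofEquiv _ (equivProd n)

/-- The inclusion of one end of the prism. -/
def face (n : ℕ) (ε : Fin 2) : Fin (n + 1) →o Prism n :=
  ⟨fun i => ⟨i, ε⟩, fun _ _ h => ⟨h, le_rfl⟩⟩

/-- The map of prisms induced by a map of finite ordinals. -/
def mapBase {m n : ℕ} (θ : Fin (m + 1) →o Fin (n + 1)) : Prism m →o Prism n :=
  ⟨fun p => ⟨θ p.1, p.2⟩, fun _ _ h => ⟨θ.monotone h.1, h.2⟩⟩

/-- The function of the cumulative weight giving the weights of the two ends of a prism. -/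
noncomputable def level (c : ℝ≥0) (ε : Fin 2) (x : ℝ≥0) : ℝ≥0 := if ε = 0 then min x c else max x c

lemma level_mono (c : ℝ≥0) (ε : Fin 2) : Monotone (level c ε) := by
  intro x y h
  unfold level
  split_ifs
  · exact min_le_min_right _ h
  · exact max_le_max_right _ h

lemma increment_level_zero {n : ℕ} {t : Fin (n + 1) → ℝ≥0} {c : ℝ≥0} {i : Fin (n + 1)}
    (h : increment t (level c 0) i ≠ 0) : ∑ j with j < i, t j < c := by
  by_contra! hc
  apply h
  have : ∑ j with j < i, t j ≤ ∑ j with j ≤ i, t j := by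
    rw [sum_le_eq_add]
    exact le_add_self
  simp [increment, level, hc, hc.trans this]

lemma increment_level_one {n : ℕ} {t : Fin (n + 1) → ℝ≥0} {c : ℝ≥0} {i : Fin (n + 1)}
    (h : increment t (level c 1) i ≠ 0) : c < ∑ j with j ≤ i, t j := by
  by_contra! hc
  apply h
  have : ∑ j with j < i, t j ≤ ∑ j with j ≤ i, t j := by
    rw [sum_le_eq_add]
    exact le_add_self
  simp [increment, level, hc, this.trans hc]

/-- The weights on the prism of a point of the product of a simplex and an interval. -/
noncomputable def weight {n : ℕ} (t : Fin (n + 1) → ℝ≥0) (c : ℝ≥0) : Prism n →₀ ℝ≥0 :=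
  Finsupp.equivFunOnFinite.symm fun p => increment t (level c p.2) p.1

lemma weight_apply {n : ℕ} (t : Fin (n + 1) → ℝ≥0) (c : ℝ≥0) (p : Prism n) :
    weight t c p = increment t (level c p.2) p.1 := rfl

/-- The point of the prism complex given by a point of a simplex and a height. -/
noncomputable def point {n : ℕ} (t : stdSimplex ℝ (Fin (n + 1))) (τ : unitInterval) :
    ChainWeight (Prism n) where
  weight := weight (simplexWeight t) (unitInterval.toNNReal (unitInterval.symm τ))
  degree_eq := by
    set c := unitInterval.toNNReal (unitInterval.symm τ)
    have hc : c ≤ 1 := (unitInterval.symm τ).2.2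
    have h1 : ∑ i, simplexWeight t i = 1 := by
      rw [← Finsupp.degree_eq_sum, degree_simplexWeight]
    have h (ε : Fin 2) := sum_increment_add (level_mono c ε) (simplexWeight t) Finset.univ (by simp)
    simp only [h1] at h
    have h2 := h 0
    have h3 := h 1
    rw [Finsupp.degree_eq_sum]
    rw [← (equivProd n).sum_comp, Fintype.sum_prod_type]
    change ∑ i, ∑ ε, increment (simplexWeight t) (level c ε) i = 1
    simp only [Fin.sum_univ_two, Finset.sum_add_distrib]
    simp only [level, if_true, Fin.isValue, one_ne_zero, if_false, zero_min, max_eq_left hc,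
      min_eq_right hc, zero_max, add_zero] at h2 h3 ⊢
    rw [h2, add_comm]
    simpa using h3
  isChain := by
    have key : ∀ i j : Fin (n + 1),
        ∀ c, increment (simplexWeight t) (level c 0) i ≠ 0 →
        increment (simplexWeight t) (level c 1) j ≠ 0 → i ≤ j := by
      intro i j c hi hj
      by_contra! h
      refine ((increment_level_zero hi).trans (increment_level_one hj)).not_ge ?_
      refine Finset.sum_le_sum_of_subset fun k => ?_
      simp only [Finset.mem_filter_univ]
      exact fun hk => hk.trans_lt h
    rintro ⟨i, ε⟩ hi ⟨j, δ⟩ hj -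
    rw [Finset.mem_coe, Finsupp.mem_support_iff, weight_apply] at hi hj
    fin_cases ε <;> fin_cases δ
    · exact (le_total i j).imp (fun h => ⟨h, le_rfl⟩) fun h => ⟨h, le_rfl⟩
    · exact Or.inl ⟨key i j _ hi hj, zero_le_one⟩
    · exact Or.inr ⟨key j i _ hj hi, zero_le_one⟩
    · exact (le_total i j).imp (fun h => ⟨h, le_rfl⟩) fun h => ⟨h, le_rfl⟩

lemma continuous_point {n : ℕ} :
    Continuous fun p : stdSimplex ℝ (Fin (n + 1)) × unitInterval => point p.1 p.2 := by
  refine ChainWeight.continuous_of_weight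
    ⟨fun _ => ⟨Finset.univ, .of_forall fun _ => Finset.subset_univ _⟩, fun p => ?_⟩
  have h1 : Continuous fun q : stdSimplex ℝ (Fin (n + 1)) × unitInterval =>
      unitInterval.toNNReal (unitInterval.symm q.2) := by fun_prop
  have h2 (s : Finset (Fin (n + 1))) : Continuous
      fun q : stdSimplex ℝ (Fin (n + 1)) × unitInterval => ∑ j ∈ s, simplexWeight q.1 j :=
    continuous_finsetSum _ fun j _ => (continuous_simplexWeight j).comp continuous_fst
  change Continuous fun q : stdSimplex ℝ (Fin (n + 1)) × unitInterval => increment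
    (simplexWeight q.1) (level (unitInterval.toNNReal (unitInterval.symm q.2)) p.2) p.1
  unfold increment level
  split_ifs
  · exact ((h2 _).min h1).sub ((h2 _).min h1)
  · exact ((h2 _).max h1).sub ((h2 _).max h1)

lemma map_point {m n : ℕ} (θ : Fin (m + 1) →o Fin (n + 1)) (t : stdSimplex ℝ (Fin (m + 1)))
    (τ : unitInterval) :
    ChainWeight.map (mapBase θ) (point t τ) = point (stdSimplex.map θ t) τ := by
  classical
  ext1
  simp only [ChainWeight.map, point]
  ext1 ⟨k, ε⟩
  rw [mapDomain_apply_eq_sum, weight_apply, simplexWeight_map]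
  have h : ⇑(Finsupp.mapDomain θ (simplexWeight t)) =
      fun k => ∑ i with θ i = k, simplexWeight t i := by
    ext1 k
    exact mapDomain_apply_eq_sum _ _ _
  rw [h]
  refine Eq.trans ?_ (increment_map (level_mono _ ε) _ θ θ.monotone k).symm
  refine (Finset.sum_nbij' (fun i => (⟨i, ε⟩ : Prism m)) Prism.base ?_ ?_ ?_ ?_ ?_).symm
  · intro i hi
    simp only [Finset.mem_filter_univ] at hi ⊢
    exact Prism.ext hi rfl
  · rintro ⟨i, δ⟩ hi
    simp only [Finset.mem_filter_univ] at hi ⊢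
    exact congr_arg Prism.base hi
  · exact fun _ _ => rfl
  · rintro ⟨i, δ⟩ hi
    simp only [Finset.mem_filter_univ] at hi
    exact Prism.ext rfl (congr_arg Prism.height hi).symm
  · exact fun _ _ => rfl

lemma point_eq_face {n : ℕ} (t : stdSimplex ℝ (Fin (n + 1))) (τ : unitInterval) (ε : Fin 2)
    (h : ∀ (i : Fin (n + 1)) (δ : Fin 2),
      increment (simplexWeight t) (level (unitInterval.toNNReal (unitInterval.symm τ)) δ) i =
        if δ = ε then simplexWeight t i else 0) :
    point t τ = ChainWeight.ofSimplex (face n ε) t := by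
  classical
  ext1
  simp only [ChainWeight.ofSimplex, point]
  ext1 ⟨i, δ⟩
  rw [weight_apply, h, mapDomain_apply_eq_sum]
  split_ifs with hδ
  · subst hδ
    rw [Finset.sum_eq_single i]
    · intro j hj hne
      simp only [Finset.mem_filter_univ] at hj
      exact absurd (congr_arg Prism.base hj) hne
    · exact fun hi => (hi (Finset.mem_filter_univ _ |>.2 rfl)).elim
  · refine (Finset.sum_eq_zero fun j hj => ?_).symm
    simp only [Finset.mem_filter_univ] at hj
    exact absurd (congr_arg Prism.height hj).symm hδ

lemma point_zero {n : ℕ} (t : stdSimplex ℝ (Fin (n + 1))) :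
    point t 0 = ChainWeight.ofSimplex (face n 0) t := by
  refine point_eq_face _ _ _ fun i δ => ?_
  have h (s : Finset (Fin (n + 1))) : ∑ j ∈ s, simplexWeight t j ≤ 1 := by
    rw [← degree_simplexWeight t, Finsupp.degree_eq_sum]
    exact Finset.sum_le_sum_of_subset (Finset.subset_univ _)
  rw [unitInterval.symm_zero, increment, level, level]
  have : unitInterval.toNNReal 1 = 1 := rfl
  split_ifs
  · rw [this, min_eq_left (h _), min_eq_left (h _), sum_le_eq_add, add_tsub_cancel_right]
  · rw [this, max_eq_right (h _), max_eq_right (h _), tsub_self]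

lemma point_one {n : ℕ} (t : stdSimplex ℝ (Fin (n + 1))) :
    point t 1 = ChainWeight.ofSimplex (face n 1) t := by
  refine point_eq_face _ _ _ fun i δ => ?_
  rw [unitInterval.symm_one, increment, level, level]
  have : unitInterval.toNNReal 0 = 0 := rfl
  fin_cases δ
  · simp [this]
  · simp [this, sum_le_eq_add]

end Prism

lemma realization_map_symm {P P' : Type} [PartialOrder P] [PartialOrder P'] (f : P →o P')
    (w : ChainWeight P) :
    SSet.toTop.map (nerveMap f.monotone.functor) ((ChainWeight.realizationHomeomorph P).symm w) =
      (ChainWeight.realizationHomeomorph P').symm (ChainWeight.map f w) := by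
  obtain ⟨n, e, t, -, rfl⟩ := w.exists_enumeration
  rw [ChainWeight.map_ofSimplex, ChainWeight.realizationHomeomorph_symm_ofSimplex,
    ChainWeight.realizationHomeomorph_symm_ofSimplex, toTop_map_realizationPoint]
  rfl

section Preorder
variable {C Q : Type} [Category.{0} C] [Quiver.IsThin C] [PartialOrder Q] {v : C → Q}
  (hv : ∀ a b, Nonempty (a ⟶ b) ↔ v a ≤ v b)

/-- The functor into a thin category given by a map which is monotone for the existence of
morphisms. -/
noncomputable def thinFunctor {D : Type} [Category.{0} D] (f : D → C)
    (hf : ∀ d d', (d ⟶ d') → v (f d) ≤ v (f d')) : D ⥤ C where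
  obj := f
  map g := ((hv _ _).2 (hf _ _ g)).some
  map_id _ := Subsingleton.elim _ _
  map_comp _ _ := Subsingleton.elim _ _

/-- The functor induced by a self-map preserving the classes of objects. -/
noncomputable def retractFunctor (r : C → C) (hr : ∀ a, v (r a) = v a) : C ⥤ C :=
  thinFunctor hv r fun a b g => by
    rw [hr, hr]
    exact (hv a b).1 ⟨g⟩

/-- The functor from a prism joining a functor to its composition with a retraction. -/
noncomputable def prismFunctor (r : C → C) (hr : ∀ a, v (r a) = v a) {n : ℕ}
    (x : Fin (n + 1) ⥤ C) : Prism n ⥤ C :=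
  thinFunctor hv (fun p => if p.height = 0 then x.obj p.base else r (x.obj p.base))
    fun p q g => by
      have h : v (x.obj p.base) ≤ v (x.obj q.base) :=
        (hv _ _).1 ⟨x.map (homOfLE (show p.base ≤ q.base from (leOfHom g).1))⟩
      have h2 (p : Prism n) : v (if p.height = 0 then x.obj p.base else r (x.obj p.base)) =
          v (x.obj p.base) := by
        split_ifs
        · rfl
        · exact hr _
      rw [h2, h2]
      exact h

/-- The realization of the nerve of a thin category is deformed along a retraction. -/
lemma homotopic_retract (r : C → C) (hr : ∀ a, v (r a) = v a) :
    (SSet.toTop.map (nerveMap (retractFunctor hv r hr))).hom.Homotopic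
      (ContinuousMap.id (SSet.toTop.obj (nerve C))) := by
  let K (n : SimplexCategory) (x : (nerve C).obj (op n)) :
      C(stdSimplex ℝ (Fin (n.len + 1)) × unitInterval, SSet.toTop.obj (nerve C)) :=
    ⟨fun p => SSet.toTop.map (nerveMap (prismFunctor hv r hr x))
      ((ChainWeight.realizationHomeomorph (Prism n.len)).symm (Prism.point p.1 p.2)),
      (SSet.toTop.map (nerveMap (prismFunctor hv r hr x))).hom.continuous.comp
        ((ChainWeight.realizationHomeomorph (Prism n.len)).symm.continuous.comp
          Prism.continuous_point)⟩
  have hK (m n : SimplexCategory) (θ : m ⟶ n) (x : (nerve C).obj (op n))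
      (t : stdSimplex ℝ (Fin (m.len + 1))) (τ : unitInterval) :
      K m ((nerve C).map θ.op x) (t, τ) = K n x (stdSimplex.map θ t, τ) := by
    have h1 : prismFunctor hv r hr ((nerve C).map θ.op x) =
        (Prism.mapBase θ.toOrderHom).monotone.functor ⋙ prismFunctor hv r hr x :=
      CategoryTheory.Functor.ext (fun _ => rfl) fun _ _ _ => Subsingleton.elim _ _
    change SSet.toTop.map (nerveMap (prismFunctor hv r hr _)) _ =
      SSet.toTop.map (nerveMap (prismFunctor hv r hr _)) _
    have h2 := Prism.map_point θ.toOrderHom t τ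
    refine Eq.trans ?_ (congr_arg (fun w => SSet.toTop.map (nerveMap (prismFunctor hv r hr x))
      ((ChainWeight.realizationHomeomorph (Prism n.len)).symm w)) h2)
    beta_reduce
    rw [h1, ← realization_map_symm]
    change SSet.toTop.map (nerveMap (Prism.mapBase θ.toOrderHom).monotone.functor ≫
      nerveMap (prismFunctor hv r hr x)) _ = _
    rw [SSet.toTop.map_comp]
    rfl
  have hface (n : SimplexCategory) (x : (nerve C).obj (op n)) (ε : Fin 2)
      (t : stdSimplex ℝ (Fin (n.len + 1))) (y : (nerve C).obj (op n))
      (hy : (Prism.face n.len ε).monotone.functor ⋙ prismFunctor hv r hr x = y) :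
      SSet.toTop.map (nerveMap (prismFunctor hv r hr x))
        ((ChainWeight.realizationHomeomorph (Prism n.len)).symm
          (ChainWeight.ofSimplex (Prism.face n.len ε) t)) = realizationPoint y t := by
    rw [ChainWeight.realizationHomeomorph_symm_ofSimplex, toTop_map_realizationPoint, ← hy]
    rfl
  obtain ⟨F, hF⟩ := exists_realization_desc (X := nerve C)
    (Z := C(unitInterval, SSet.toTop.obj (nerve C))) (fun n x => (K n x).curry)
    fun m n θ x t => ContinuousMap.ext fun τ => hK m n θ x t τ
  have heval (τ : unitInterval) (g : C(SSet.toTop.obj (nerve C), SSet.toTop.obj (nerve C)))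
      (h : ∀ (n : SimplexCategory) (x : (nerve C).obj (op n)) (t : stdSimplex ℝ (Fin (n.len + 1))),
        K n x (t, τ) = g (realizationPoint x t)) (z : SSet.toTop.obj (nerve C)) :
      F z τ = g z := by
    let G : C(SSet.toTop.obj (nerve C), SSet.toTop.obj (nerve C)) :=
      ⟨fun z => F z τ, (continuous_eval_const τ).comp F.continuous⟩
    have : G = g := realization_hom_ext fun n x t => by
      rw [← h]
      exact DFunLike.congr_fun (hF n x t) τ
    exact DFunLike.congr_fun this z
  refine ContinuousMap.Homotopic.symm
    ⟨⟨F.uncurry.comp ContinuousMap.prodSwap, fun z => ?_, fun z => ?_⟩⟩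
  · refine heval 0 _ (fun n x t => ?_) z
    change SSet.toTop.map _ ((ChainWeight.realizationHomeomorph _).symm (Prism.point t 0)) = _
    rw [Prism.point_zero]
    exact hface n x 0 t x
      (CategoryTheory.Functor.ext (fun _ => rfl) fun _ _ _ => Subsingleton.elim _ _)
  · refine heval 1 _ (fun n x t => ?_) z
    change SSet.toTop.map _ ((ChainWeight.realizationHomeomorph _).symm (Prism.point t 1)) =
      SSet.toTop.map _ _
    rw [Prism.point_one, toTop_map_realizationPoint]
    exact hface n x 1 t _
      (CategoryTheory.Functor.ext (fun _ => rfl) fun _ _ _ => Subsingleton.elim _ _)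

/-- The realization of the nerve of a thin category is homotopy equivalent to that of
the ordered set of its isomorphism classes. -/
lemma nonempty_homotopyEquiv_nerve
    (hv : ∀ a b, Nonempty (a ⟶ b) ↔ v a ≤ v b) (hsurj : Function.Surjective v) :
    Nonempty (ContinuousMap.HomotopyEquiv (SSet.toTop.obj (nerve C))
      (SSet.toTop.obj (nerve Q))) := by
  let π : C ⥤ Q :=
    { obj := v
      map := fun g => homOfLE ((hv _ _).1 ⟨g⟩)
      map_id := fun _ => Subsingleton.elim _ _
      map_comp := fun _ _ => Subsingleton.elim _ _ }
  let s := Function.surjInv hsurj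
  have hs : ∀ q, v (s q) = q := Function.surjInv_eq hsurj
  let ρ : Q ⥤ C := thinFunctor hv s fun q q' g => by
    rw [hs, hs]
    exact leOfHom g
  have h1 : π ⋙ ρ = retractFunctor hv (fun a => s (v a)) fun a => hs _ := rfl
  have h2 : ρ ⋙ π = 𝟭 Q := CategoryTheory.Functor.ext hs fun _ _ _ => Subsingleton.elim _ _
  refine ⟨⟨(SSet.toTop.map (nerveMap π)).hom, (SSet.toTop.map (nerveMap ρ)).hom, ?_, ?_⟩⟩
  · have h := homotopic_retract hv (fun a => s (v a)) fun a => hs _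
    rw [← h1] at h
    convert h
    change _ = (SSet.toTop.map (nerveMap π ≫ nerveMap ρ)).hom
    rw [SSet.toTop.map_comp]
    rfl
  · convert ContinuousMap.Homotopic.refl _
    have h3 : SSet.toTop.map (nerveMap ρ ≫ nerveMap π) = 𝟙 _ := by
      change SSet.toTop.map (nerveMap (ρ ⋙ π)) = _
      rw [h2]
      exact SSet.toTop.map_id _
    rw [SSet.toTop.map_comp] at h3
    exact (congr_arg TopCat.Hom.hom h3).symm

end Preorder

/-- The map `h` contracts `U` inside itself to the point `p`, the behaviour outside `U` being
irrelevant at intermediate times. -/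
structure IsContraction {Y : Type} [TopologicalSpace Y] (U : Set Y) (h : Y → unitInterval → Y)
    (p : Y) : Prop where
  mem : p ∈ U
  zero : ∀ y, h y 0 = y
  one : ∀ y, h y 1 = p
  mapsTo : ∀ y ∈ U, ∀ s, h y s ∈ U
  cont : ContinuousOn (fun z : Y × unitInterval => h z.1 z.2) (U ×ˢ Set.univ)

lemma exists_isContraction {Y : Type} [TopologicalSpace Y] (U : Set Y) [ContractibleSpace U] :
    ∃ h p, IsContraction U h p := by
  classical
  obtain ⟨p, ⟨H⟩⟩ := id_nullhomotopic U
  refine ⟨fun y s => if s = 1 then p else if hy : y ∈ U then H (s, ⟨y, hy⟩) else y, p,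
    p.2, fun y => ?_, fun y => by simp, fun y hy s => ?_, ?_⟩
  · simp
  · simp only [hy, dite_true]
    split_ifs
    · exact p.2
    · exact (H _).2
  · rw [continuousOn_iff_continuous_domRestrict]
    have : Continuous fun z : ↥(U ×ˢ (Set.univ : Set unitInterval)) =>
        (H (z.1.2, ⟨z.1.1, z.2.1⟩) : Y) := by fun_prop
    refine this.congr fun z => ?_
    have hz : z.1.1 ∈ U := z.2.1
    simp only [Set.domRestrict_apply, hz, dite_true]
    split_ifs with h1
    · rw [h1]
      simp
    · rfl

/-- A parameter in the unit interval comparing two weights. -/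
noncomputable def blend (a c : ℝ≥0) : unitInterval :=
  Set.projIcc 0 1 zero_le_one ((3 * (a - c) / (a + c) : ℝ))

lemma blend_eq_zero {a c : ℝ≥0} (h : a ≤ c) : blend a c = 0 := by
  refine Set.projIcc_of_le_left _ (div_nonpos_of_nonpos_of_nonneg ?_ (by positivity))
  have : (a : ℝ) ≤ c := h
  linarith

lemma blend_eq_one {a c : ℝ≥0} (h : 2 * c ≤ a) (ha : a ≠ 0) : blend a c = 1 := by
  refine Set.projIcc_of_right_le _ ?_
  have h1 : (2 * c : ℝ) ≤ a := h
  have h2 : (0 : ℝ) < a := NNReal.coe_pos.2 (pos_iff_ne_zero.2 ha)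
  have h3 : (0 : ℝ) ≤ c := c.2
  rw [le_div_iff₀ (by linarith)]
  linarith

lemma continuousAt_blend {a c : ℝ≥0} (h : a ≠ 0 ∨ c ≠ 0) :
    ContinuousAt (fun p : ℝ≥0 × ℝ≥0 => blend p.1 p.2) (a, c) := by
  refine continuous_projIcc.continuousAt.comp (ContinuousAt.div ?_ ?_ ?_)
  · fun_prop
  · fun_prop
  · simp only [ne_eq]
    have h2 : (0 : ℝ) ≤ a := a.2
    have h3 : (0 : ℝ) ≤ c := c.2
    intro h4
    rcases h with h | h
    · exact h (NNReal.coe_eq_zero.1 (by linarith))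
    · exact h (NNReal.coe_eq_zero.1 (by linarith))

section Flow
variable {Y Q : Type} (h : Q → Y → unitInterval → Y)

/-- Successively apply contractions along a list, with amounts governed by weights. -/
noncomputable def flow (w : Q → ℝ≥0) : List Q → Y → ℝ≥0 → Y
  | [], x, _ => x
  | q :: l, x, c => flow w l (h q x (blend (w q) c)) (max c (w q))

variable [TopologicalSpace Y] {U : Q → Set Y} {p : Q → Y} {h}
  (hU : ∀ q, IsContraction (U q) (h q) (p q))
include hU

lemma flow_eq_self {w : Q → ℝ≥0} {l : List Q} {x : Y} {c : ℝ≥0} (hw : ∀ q ∈ l, w q ≤ c) :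
    flow h w l x c = x := by
  induction l with
  | nil => rfl
  | cons q l ih =>
    rw [List.forall_mem_cons] at hw
    rw [flow, blend_eq_zero hw.1, (hU q).zero, max_eq_left hw.1]
    exact ih hw.2

lemma flow_filter (w : Q → ℝ≥0) (l : List Q) (x : Y) (c : ℝ≥0) :
    flow h w (l.filter fun q => w q ≠ 0) x c = flow h w l x c := by
  induction l generalizing x c with
  | nil => rfl
  | cons q l ih =>
    by_cases hq : w q = 0
    · rw [List.filter_cons_of_neg (by simpa using hq), ih, flow, hq, blend_eq_zero zero_le,
        (hU q).zero, max_eq_left zero_le]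
    · rw [List.filter_cons_of_pos (by simpa using hq), flow, flow, ih]

lemma flow_start {w : Q → ℝ≥0} {l : List Q} (hw : ∃ q ∈ l, w q ≠ 0) (x x' : Y) :
    flow h w l x 0 = flow h w l x' 0 := by
  induction l with
  | nil => simp at hw
  | cons q l ih =>
    by_cases hq : w q = 0
    · rw [flow, flow, hq, blend_eq_zero le_rfl, (hU q).zero, (hU q).zero, max_self]
      refine ih ?_
      simpa [hq] using hw
    · rw [flow, flow, blend_eq_one (by simp) hq, (hU q).one, (hU q).one]

lemma flow_step_mem {w : Q → ℝ≥0} {q : Q} {x : Y} {c : ℝ≥0} (hc : c ≠ 0 → x ∈ U q)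
    (hq : w q ≠ 0) : h q x (blend (w q) c) ∈ U q := by
  by_cases h0 : c = 0
  · rw [h0, blend_eq_one (by simp) hq, (hU q).one]
    exact (hU q).mem
  · exact (hU q).mapsTo _ (hc h0) _

variable [PartialOrder Q] (hmono : Monotone U)
include hmono

lemma flow_step_inv {w : Q → ℝ≥0} {q : Q} {l : List Q} (hl : (q :: l).Pairwise (· < ·))
    {x : Y} {c : ℝ≥0} (hc : c ≠ 0 → ∀ q' ∈ q :: l, w q' ≠ 0 → x ∈ U q')
    (_ : max c (w q) ≠ 0) (q' : Q) (hq' : q' ∈ l) (hw : w q' ≠ 0) :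
    h q x (blend (w q) c) ∈ U q' := by
  by_cases hq : w q = 0
  · rw [hq, blend_eq_zero zero_le, (hU q).zero]
    refine hc ?_ q' (List.mem_cons_of_mem _ hq') hw
    simp_all
  · exact hmono (List.rel_of_pairwise_cons hl hq').le
      (flow_step_mem hU (fun h0 => hc h0 q List.mem_cons_self hq) hq)

lemma flow_mem {w : Q → ℝ≥0} {l : List Q} (hl : l.Pairwise (· < ·)) {x : Y} {c : ℝ≥0}
    (hc : c ≠ 0 → ∀ q ∈ l, w q ≠ 0 → x ∈ U q) {q : Q} (hq : q ∈ l) (hw : w q ≠ 0)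
    (hlt : ∀ q' ∈ l, q < q' → w q' < w q) : flow h w l x c ∈ U q := by
  induction l generalizing x c with
  | nil => simp at hq
  | cons q₀ l ih =>
    rw [flow]
    rcases List.mem_cons.1 hq with rfl | hq'
    · rw [flow_eq_self hU]
      · exact flow_step_mem hU (fun h0 => hc h0 q List.mem_cons_self hw) hw
      · exact fun q' hq' => (hlt q' (List.mem_cons_of_mem _ hq')
          (List.rel_of_pairwise_cons hl hq')).le.trans (le_max_right _ _)
    · exact ih hl.of_cons (flow_step_inv hU hmono hl hc) hq'
        fun q' hq' => hlt q' (List.mem_cons_of_mem _ hq')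

lemma continuousAt_flow (hopen : ∀ q, IsOpen (U q)) {Z : Type} [TopologicalSpace Z]
    {w : Z → Q → ℝ≥0} (hw : ∀ q, Continuous fun z => w z q) {l : List Q}
    (hl : l.Pairwise (· < ·)) {x : Z → Y} {c : Z → ℝ≥0} (hcont : Continuous c)
    (hx : ∀ z, c z ≠ 0 → ContinuousAt x z)
    (hc : ∀ z, c z ≠ 0 → ∀ q ∈ l, w z q ≠ 0 → x z ∈ U q) (z : Z)
    (hz : c z ≠ 0 ∨ ∃ q ∈ l, w z q ≠ 0) :
    ContinuousAt (fun z => flow h (w z) l (x z) (c z)) z := by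
  induction l generalizing x c with
  | nil =>
    refine hx z ?_
    simpa using hz
  | cons q l ih =>
    simp only [flow]
    refine ih hl.of_cons (hcont.max (hw q)) (fun z hz => ?_)
      (fun z => flow_step_inv hU hmono hl (hc z)) ?_
    · rcases lt_or_ge (w z q) (c z) with h1 | h1
      · refine (hx z (zero_le.trans_lt h1).ne').congr ?_
        filter_upwards [(isOpen_lt (hw q) hcont).mem_nhds h1] with z' hz'
        rw [blend_eq_zero (le_of_lt hz'), (hU q).zero]
      rcases lt_or_ge (2 * c z) (w z q) with h2 | h2
      · refine (continuousAt_const (y := p q)).congr ?_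
        filter_upwards [(isOpen_lt (continuous_const.mul hcont) (hw q)).mem_nhds h2] with z' hz'
        have h3 : 2 * c z' < w z' q := hz'
        rw [blend_eq_one h3.le (zero_le.trans_lt h3).ne', (hU q).one]
      have h3 : c z ≠ 0 := by
        intro h0
        rw [h0, mul_zero] at h2
        simp [h0, le_antisymm h2 zero_le] at hz
      have h4 : w z q ≠ 0 := fun h0 => h3 (le_antisymm (h1.trans h0.le) zero_le)
      have h5 : x z ∈ U q := hc z h3 q List.mem_cons_self h4
      have h6 : ContinuousAt (fun z : Y × unitInterval => h q z.1 z.2)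
          (x z, blend (w z q) (c z)) :=
        (hU q).cont.continuousAt (((hopen q).prod isOpen_univ).mem_nhds ⟨h5, trivial⟩)
      have h7 : ContinuousAt (fun z => blend (w z q) (c z)) z :=
        ContinuousAt.comp (f := fun z => (w z q, c z)) (continuousAt_blend (Or.inl h4))
          ((hw q).prodMk hcont).continuousAt
      exact ContinuousAt.comp (f := fun z => (x z, blend (w z q) (c z))) h6
        ((hx z h3).prodMk h7)
    · rcases hz with hz | ⟨q', hq', hz⟩
      · exact Or.inl fun h0 => hz (le_antisymm ((le_max_left _ _).trans h0.le) zero_le)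
      · rcases List.mem_cons.1 hq' with rfl | hq'
        · exact Or.inl fun h0 => hz (le_antisymm ((le_max_right _ _).trans h0.le) zero_le)
        · exact Or.inr ⟨q', hq', hz⟩

end Flow

section ChainList
variable {Q : Type} [PartialOrder Q]

lemma exists_chainList (S : Finset Q) (hS : IsChain (· ≤ ·) (S : Set Q)) :
    ∃ l : List Q, l.Pairwise (· < ·) ∧ ∀ q, q ∈ l ↔ q ∈ S := by
  rcases S.eq_empty_or_nonempty with rfl | hne
  · exact ⟨[], List.Pairwise.nil, by simp⟩
  obtain ⟨n, e, he⟩ := exists_chain_enumeration S hS hne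
  refine ⟨List.ofFn e, List.pairwise_ofFn.2 fun i j hij => e.strictMono hij, fun q => ?_⟩
  rw [List.mem_ofFn, ← Set.mem_range, he, Finset.mem_coe]

open scoped Classical in
/-- The increasing enumeration of a finite chain. -/
noncomputable def chainList (S : Finset Q) : List Q :=
  if hS : IsChain (· ≤ ·) (S : Set Q) then (exists_chainList S hS).choose else []

lemma chainList_pairwise (S : Finset Q) : (chainList S).Pairwise (· < ·) := by
  rw [chainList]
  split_ifs with hS
  · exact (exists_chainList S hS).choose_spec.1
  · exact List.Pairwise.nil

lemma mem_chainList {S : Finset Q} (hS : IsChain (· ≤ ·) (S : Set Q)) {q : Q} :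
    q ∈ chainList S ↔ q ∈ S := by
  rw [chainList, dif_pos hS]
  exact (exists_chainList S hS).choose_spec.2 q

lemma pairwise_lt_ext {l l' : List Q} (hl : l.Pairwise (· < ·)) (hl' : l'.Pairwise (· < ·))
    (h : ∀ q, q ∈ l ↔ q ∈ l') : l = l' :=
  ((List.perm_ext_iff_of_nodup (hl.imp fun h => h.ne) (hl'.imp fun h => h.ne)).2 h).eq_of_pairwise
    (fun _ _ _ _ h1 h2 => (h1.asymm h2).elim) hl hl'

lemma chainList_filter {S T : Finset Q} (hS : IsChain (· ≤ ·) (S : Set Q)) (hT : T ⊆ S)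
    (P : Q → Bool) (hP : ∀ q ∈ S, P q ↔ q ∈ T) : (chainList S).filter P = chainList T := by
  refine pairwise_lt_ext ((chainList_pairwise S).filter _) (chainList_pairwise T) fun q => ?_
  have hT' : IsChain (· ≤ ·) (T : Set Q) := hS.mono (Finset.coe_subset.2 hT)
  rw [List.mem_filter, mem_chainList hS, mem_chainList hT']
  exact ⟨fun h => (hP q h.1).1 h.2, fun h => ⟨hT h, (hP q (hT h)).2 h⟩⟩

end ChainList

section SupportFlow
variable {Y Q : Type} [PartialOrder Q] (h : Q → Y → unitInterval → Y)

/-- Flow along the increasing enumeration of the support of a weight. -/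
noncomputable def supportFlow (w : Q →₀ ℝ≥0) (x : Y) (c : ℝ≥0) : Y :=
  flow h w (chainList w.support) x c

variable [TopologicalSpace Y] {U : Q → Set Y} {p : Q → Y} {h}
  (hU : ∀ q, IsContraction (U q) (h q) (p q))
include hU

lemma supportFlow_eq {S : Finset Q} (hS : IsChain (· ≤ ·) (S : Set Q)) {w : Q →₀ ℝ≥0}
    (hw : w.support ⊆ S) (x : Y) (c : ℝ≥0) :
    supportFlow h w x c = flow h w (chainList S) x c := by
  rw [supportFlow, ← flow_filter hU, ← flow_filter hU _ (chainList S)]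
  rw [chainList_filter hS hw _ (by simp), chainList_filter (hS.mono (Finset.coe_subset.2 hw))
    subset_rfl _ (by simp)]

lemma supportFlow_start {w : Q →₀ ℝ≥0} (hw : w ≠ 0)
    (hc : IsChain (· ≤ ·) (w.support : Set Q)) (x x' : Y) :
    supportFlow h w x 0 = supportFlow h w x' 0 := by
  obtain ⟨q, hq⟩ := Finsupp.support_nonempty_iff.2 hw
  exact flow_start hU ⟨q, (mem_chainList hc).2 hq, Finsupp.mem_support_iff.1 hq⟩ x x'

lemma continuous_supportFlow (hmono : Monotone U) (hopen : ∀ q, IsOpen (U q)) {Z : Type}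
    [TopologicalSpace Z] {w : Z → Q →₀ ℝ≥0} (hw : LocFinCont w)
    (hchain : ∀ z, IsChain (· ≤ ·) ((w z).support : Set Q)) {x : Z → Y} {c : Z → ℝ≥0}
    (hcont : Continuous c) (hx : ∀ z, c z ≠ 0 → ContinuousAt x z)
    (hc : ∀ z, c z ≠ 0 → ∀ q ∈ (w z).support, x z ∈ U q)
    (hne : ∀ z, c z ≠ 0 ∨ w z ≠ 0) :
    Continuous fun z => supportFlow h (w z) (x z) (c z) := by
  refine hw.continuous_of_pieces hchain fun S hS => ?_
  rw [continuousOn_iff_continuous_domRestrict, continuous_iff_continuousAt]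
  intro z
  have := continuousAt_flow hU hmono hopen
    (Z := {z | ((w z).support : Set Q) ⊆ S}) (w := fun z => w z)
    (fun q => (hw.cont q).comp continuous_subtype_val) (chainList_pairwise S)
    (x := fun z => x z) (c := fun z => c z) (hcont.comp continuous_subtype_val)
    (fun z hz => (hx z hz).comp continuous_subtype_val.continuousAt)
    (fun z hz q _ hq => hc z hz q (Finsupp.mem_support_iff.2 hq)) z
    ((hne z).imp_right fun hz => by
      obtain ⟨q, hq⟩ := Finsupp.support_nonempty_iff.2 hz
      exact ⟨q, (mem_chainList hS).2 (Finset.mem_coe.1 (z.2 hq)), Finsupp.mem_support_iff.1 hq⟩)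
  refine this.congr (.of_forall fun z => ?_)
  exact (supportFlow_eq hU hS (Finset.coe_subset.1 z.2) _ _).symm

end SupportFlow

section Weights
variable {Q : Type}

lemma sup_eq_sup_of_subset {A B : Finset Q} (hAB : A ⊆ B) {w : Q → ℝ≥0}
    (hw : ∀ q ∈ B, q ∉ A → w q = 0) : A.sup w = B.sup w := by
  refine le_antisymm (Finset.sup_mono hAB) (Finset.sup_le fun q hq => ?_)
  by_cases hA : q ∈ A
  · exact Finset.le_sup hA
  · rw [hw q hq hA]
    exact zero_le

open scoped Classical in
/-- Distance of the values of `ψ` on `S` above its values on the rest of `F`. -/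
noncomputable def levelGap (F : Finset Q) (ψ : Q →₀ ℝ≥0) (S : Finset Q) : ℝ≥0 :=
  ∏ s ∈ S, (ψ s - (F \ S).sup ψ)

open scoped Classical in
/-- The weights on a label `γ S` for every superlevel set `S ⊆ F` of `ψ`. -/
noncomputable def subdivideOn (γ : Finset Q → Q) (F : Finset Q) (ψ : Q →₀ ℝ≥0) : Q →₀ ℝ≥0 :=
  ∑ S ∈ F.powerset with S.Nonempty, Finsupp.single (γ S) (levelGap F ψ S)

/-- The weights on a label `γ S` for every superlevel set `S` of `ψ`. -/
noncomputable def subdivide (γ : Finset Q → Q) (ψ : Q →₀ ℝ≥0) : Q →₀ ℝ≥0 :=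
  subdivideOn γ ψ.support ψ

lemma subdivideOn_eq (γ : Finset Q → Q) {F : Finset Q} {ψ : Q →₀ ℝ≥0} (hF : ψ.support ⊆ F) :
    subdivideOn γ F ψ = subdivide γ ψ := by
  classical
  rw [subdivide, subdivideOn, subdivideOn]
  symm
  refine Finset.sum_subset_zero_on_sdiff ?_ ?_ ?_
  · exact Finset.filter_subset_filter _ (Finset.powerset_mono.2 hF)
  · intro S hS
    simp only [Finset.mem_sdiff, Finset.mem_filter, Finset.mem_powerset, not_and'] at hS
    obtain ⟨s, hs, hs'⟩ := Finset.not_subset.1 (hS.2 hS.1.2)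
    rw [levelGap, Finset.prod_eq_zero hs, Finsupp.single_zero]
    rw [Finsupp.notMem_support_iff.1 hs', zero_tsub]
  · intro S hS
    rw [levelGap, levelGap, sup_eq_sup_of_subset (Finset.sdiff_subset_sdiff hF subset_rfl)]
    intro q hq hq'
    by_contra h0
    exact hq' (Finset.mem_sdiff.2 ⟨Finsupp.mem_support_iff.2 h0, (Finset.mem_sdiff.1 hq).2⟩)

lemma exists_of_mem_support_subdivide {γ : Finset Q → Q} {ψ : Q →₀ ℝ≥0} {q : Q}
    (hq : q ∈ (subdivide γ ψ).support) :
    ∃ S ⊆ ψ.support, S.Nonempty ∧ γ S = q ∧ ∀ s ∈ S, ∀ r ∈ ψ.support, r ∉ S → ψ r < ψ s := by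
  classical
  rw [subdivide, subdivideOn] at hq
  obtain ⟨S, hS, hq⟩ := Finset.mem_biUnion.1 (Finsupp.support_finsetSum hq)
  rw [Finset.mem_filter, Finset.mem_powerset] at hS
  obtain ⟨hq1, hq2⟩ := Finsupp.mem_support_single _ _ _ |>.1 hq
  refine ⟨S, hS.1, hS.2, hq1.symm, fun s hs r hr hrS => ?_⟩
  have h1 := Finset.prod_ne_zero_iff.1 hq2 s hs
  exact (Finset.le_sup (f := ψ) (Finset.mem_sdiff.2 ⟨hr, hrS⟩)).trans_lt
    (tsub_pos_iff_lt.1 (pos_iff_ne_zero.2 h1))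

lemma subdivide_ne_zero (γ : Finset Q → Q) {ψ : Q →₀ ℝ≥0} (hψ : ψ ≠ 0) : subdivide γ ψ ≠ 0 := by
  classical
  intro h0
  have h1 := DFunLike.congr_fun h0 (γ ψ.support)
  rw [subdivide, subdivideOn, Finsupp.finsetSum_apply, Finsupp.zero_apply,
    Finset.sum_eq_zero_iff] at h1
  have h2 := h1 ψ.support (by simpa using hψ)
  rw [Finsupp.single_eq_same, levelGap, Finset.prod_eq_zero_iff] at h2
  obtain ⟨s, hs, h2⟩ := h2
  simp only [Finset.sdiff_self, Finset.sup_empty, bot_eq_zero, tsub_zero] at h2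
  exact Finsupp.mem_support_iff.1 hs h2

lemma LocFinCont.subdivide {Z : Type} [TopologicalSpace Z] {ψ : Z → Q →₀ ℝ≥0}
    (h : LocFinCont ψ) (γ : Finset Q → Q) : LocFinCont fun z => subdivide γ (ψ z) := by
  classical
  refine h.transform (fun F => ⟨F.powerset.image γ, fun z hz q hq => ?_⟩) fun F q =>
    ⟨fun z => subdivideOn γ F (ψ z) q, ?_, fun z hz =>
      (DFunLike.congr_fun (subdivideOn_eq γ hz) q).symm⟩
  · obtain ⟨S, hS, -, rfl, -⟩ := exists_of_mem_support_subdivide hq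
    exact Finset.mem_image_of_mem _ (Finset.mem_powerset.2 (hS.trans hz))
  · simp only [subdivideOn, Finsupp.finsetSum_apply, Finsupp.single_apply, levelGap]
    refine continuous_finsetSum _ fun S _ => ?_
    split_ifs
    · exact continuous_finsetProd _ fun s _ => (h.cont s).sub
        (Continuous.finset_sup_apply fun q _ => h.cont q)
    · exact continuous_const

section Order
variable [PartialOrder Q]

open scoped Classical in
/-- The amount by which a weight exceeds all the weights of larger elements. -/
noncomputable def excess (w : Q →₀ ℝ≥0) : Q →₀ ℝ≥0 :=
  Finsupp.onFinset w.support (fun q => w q - (w.support.filter (q < ·)).sup w) fun q hq => by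
    rw [Finsupp.mem_support_iff]
    exact fun h0 => hq (by rw [h0, zero_tsub])

lemma support_excess_subset (w : Q →₀ ℝ≥0) : (excess w).support ⊆ w.support :=
  Finsupp.support_onFinset_subset

lemma lt_of_mem_support_excess {w : Q →₀ ℝ≥0} {q q' : Q} (hq : q ∈ (excess w).support)
    (h : q < q') : w q' < w q := by
  classical
  have h0 : 0 < w q - (w.support.filter (q < ·)).sup w :=
    pos_iff_ne_zero.2 (Finsupp.mem_support_iff.1 hq)
  have h1 := tsub_pos_iff_lt.1 h0
  by_cases h2 : q' ∈ w.support
  · exact (Finset.le_sup (f := w) (Finset.mem_filter.2 ⟨h2, h⟩)).trans_lt h1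
  · rw [Finsupp.notMem_support_iff.1 h2]
    exact zero_le.trans_lt h1

lemma excess_ne_zero {w : Q →₀ ℝ≥0} (hw : w ≠ 0) : excess w ≠ 0 := by
  classical
  obtain ⟨q, hq⟩ := Finset.exists_maximal (Finsupp.support_nonempty_iff.2 hw)
  intro h0
  have h1 : w q - (w.support.filter (q < ·)).sup w = 0 := DFunLike.congr_fun h0 q
  rw [Finset.filter_eq_empty_iff.2 fun r hr hlt => hq.not_gt hr hlt, Finset.sup_empty,
    bot_eq_zero, tsub_zero] at h1
  exact Finsupp.mem_support_iff.1 hq.prop h1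

lemma LocFinCont.excess {Z : Type} [TopologicalSpace Z] {ψ : Z → Q →₀ ℝ≥0}
    (h : LocFinCont ψ) : LocFinCont fun z => excess (ψ z) := by
  classical
  refine h.transform (fun F => ⟨F, fun z hz => (support_excess_subset _).trans hz⟩) fun F q =>
    ⟨fun z => ψ z q - (F.filter (q < ·)).sup (ψ z), (h.cont q).sub
      (Continuous.finset_sup_apply fun q _ => h.cont q), fun z hz => ?_⟩
  change ψ z q - ((ψ z).support.filter (q < ·)).sup (ψ z) = _
  rw [sup_eq_sup_of_subset (Finset.filter_subset_filter _ hz)]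
  intro r hr hr'
  by_contra h0
  exact hr' (Finset.mem_filter.2 ⟨Finsupp.mem_support_iff.2 h0, (Finset.mem_filter.1 hr).2⟩)

end Order

section Cover
variable {Y : Type} {U : Q → Set Y} {γ : Finset Q → Q}
  (hγ : ∀ S : Finset Q, S.Nonempty → ∀ y, (∀ s ∈ S, y ∈ U s) → U (γ S) = ⋂ s ∈ S, U s)
include hγ

lemma mem_of_mem_support_subdivide {ψ : Q →₀ ℝ≥0} {y : Y} (hy : ∀ q ∈ ψ.support, y ∈ U q) {q : Q}
    (hq : q ∈ (subdivide γ ψ).support) : y ∈ U q := by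
  obtain ⟨S, hS, hne, rfl, -⟩ := exists_of_mem_support_subdivide hq
  rw [hγ S hne y fun s hs => hy s (hS hs)]
  exact Set.mem_iInter₂.2 fun s hs => hy s (hS hs)

variable [PartialOrder Q] (hle : ∀ q r, U q ⊆ U r ↔ q ≤ r)
include hle

lemma isChain_support_subdivide {ψ : Q →₀ ℝ≥0} {y : Y} (hy : ∀ q ∈ ψ.support, y ∈ U q) :
    IsChain (· ≤ ·) ((subdivide γ ψ).support : Set Q) := by
  intro q hq q' hq' _
  obtain ⟨S, hS, hne, rfl, hlt⟩ := exists_of_mem_support_subdivide hq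
  obtain ⟨S', hS', hne', rfl, hlt'⟩ := exists_of_mem_support_subdivide hq'
  have key (T T' : Finset Q) (hT : T ⊆ ψ.support) (hT' : T' ⊆ ψ.support) (hn : T.Nonempty)
      (hn' : T'.Nonempty) (h : T ⊆ T') : γ T' ≤ γ T := by
    rw [← hle, hγ T hn y fun s hs => hy s (hT hs), hγ T' hn' y fun s hs => hy s (hT' hs)]
    exact Set.biInter_subset_biInter_left h
  by_cases h : S ⊆ S'
  · exact Or.inr (key S S' hS hS' hne hne' h)
  refine Or.inl (key S' S hS' hS hne' hne fun s' hs' => ?_)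
  by_contra hs'S
  obtain ⟨s, hs, hsS'⟩ := Finset.not_subset.1 h
  exact (hlt s hs s' (hS' hs') hs'S).asymm (hlt' s' hs' s (hS hs) hsS')

lemma support_subdivide_subset {ψ : Q →₀ ℝ≥0} (hne : ∀ q, (U q).Nonempty)
    (hψ : IsChain (· ≤ ·) (ψ.support : Set Q)) : (subdivide γ ψ).support ⊆ ψ.support := by
  intro q hq
  obtain ⟨S, hS, hSne, rfl, -⟩ := exists_of_mem_support_subdivide hq
  obtain ⟨m, hm⟩ := S.exists_minimal hSne
  have hmin : ∀ s ∈ S, m ≤ s := fun s hs =>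
    (hψ.total (hS hm.prop) (hS hs)).elim id fun h => hm.le_of_le hs h
  obtain ⟨y, hy⟩ := hne m
  have h := hγ S hSne y fun s hs => (hle m s).2 (hmin s hs) hy
  have : γ S = m := by
    refine le_antisymm ((hle _ _).1 ?_) ((hle _ _).1 ?_)
    · rw [h]
      exact Set.biInter_subset_of_mem hm.prop
    · rw [h]
      exact Set.subset_iInter₂ fun s hs => (hle m s).2 (hmin s hs)
  rw [this]
  exact hS hm.prop

end Cover

/-- Convex combination of weights. -/
noncomputable def mix (τ : unitInterval) (w w' : Q →₀ ℝ≥0) : Q →₀ ℝ≥0 :=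
  unitInterval.toNNReal (unitInterval.symm τ) • w + unitInterval.toNNReal τ • w'

lemma mix_zero (w w' : Q →₀ ℝ≥0) : mix 0 w w' = w := by
  have h0 : unitInterval.toNNReal 0 = 0 := rfl
  have h1 : unitInterval.toNNReal 1 = 1 := rfl
  rw [mix, unitInterval.symm_zero, h0, h1, one_smul, zero_smul, add_zero]

lemma mix_one (w w' : Q →₀ ℝ≥0) : mix 1 w w' = w' := by
  have h0 : unitInterval.toNNReal 0 = 0 := rfl
  have h1 : unitInterval.toNNReal 1 = 1 := rfl
  rw [mix, unitInterval.symm_one, h0, h1, one_smul, zero_smul, zero_add]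

lemma mem_support_mix {τ : unitInterval} {w w' : Q →₀ ℝ≥0} {q : Q}
    (hq : q ∈ (mix τ w w').support) : q ∈ w.support ∨ q ∈ w'.support := by
  classical
  exact (Finset.mem_union.1 (Finsupp.support_add hq)).imp
    (fun h => Finsupp.support_smul h) fun h => Finsupp.support_smul h

lemma mix_ne_zero (τ : unitInterval) {w w' : Q →₀ ℝ≥0} (hw : w ≠ 0) (hw' : w' ≠ 0) :
    mix τ w w' ≠ 0 := by
  intro h
  rw [mix, add_eq_zero, smul_eq_zero, smul_eq_zero, or_iff_left hw, or_iff_left hw'] at h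
  have h1 : (1 - τ : ℝ) = 0 := congr_arg NNReal.toReal h.1
  have h2 : (τ : ℝ) = 0 := congr_arg NNReal.toReal h.2
  rw [h2] at h1
  norm_num at h1

lemma LocFinCont.mix {Z : Type} [TopologicalSpace Z] {ψ ψ' : Z → Q →₀ ℝ≥0} (h : LocFinCont ψ)
    (h' : LocFinCont ψ') {τ : Z → unitInterval} (hτ : Continuous τ) :
    LocFinCont fun z => mix (τ z) (ψ z) (ψ' z) :=
  (h.smul (c := fun z => unitInterval.toNNReal (unitInterval.symm (τ z))) (by fun_prop)).add
    (h'.smul (c := fun z => unitInterval.toNNReal (τ z)) (by fun_prop))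

end Weights

lemma exists_partition_weight {Y Q : Type} [TopologicalSpace Y] [ParacompactSpace Y] [T2Space Y]
    {U : Q → Set Y} (hopen : ∀ q, IsOpen (U q)) (hcover : ∀ y, ∃ q, y ∈ U q) :
    ∃ φ : Y → Q →₀ ℝ≥0, LocFinCont φ ∧ (∀ y, φ y ≠ 0) ∧ ∀ y, ∀ q ∈ (φ y).support, y ∈ U q := by
  obtain ⟨f, hf⟩ := PartitionOfUnity.exists_isSubordinate isClosed_univ U hopen
    fun y _ => Set.mem_iUnion.2 (hcover y)
  have hsupp (y : Y) (q : Q) (h : (f q y).toNNReal ≠ 0) : y ∈ Function.support (f q) :=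
    fun h0 => h (by rw [h0, Real.toNNReal_zero])
  have hfin (y : Y) : (Function.support fun q => (f q y).toNNReal).Finite :=
    (f.locallyFinite.point_finite y).subset fun q hq => hsupp y q hq
  let φ : Y → Q →₀ ℝ≥0 := fun y => Finsupp.ofSupportFinite (fun q => (f q y).toNNReal) (hfin y)
  have hφ (y : Y) (q : Q) (hq : q ∈ (φ y).support) : y ∈ Function.support (f q) :=
    hsupp y q (Finsupp.mem_support_iff.1 hq)
  refine ⟨φ, ⟨fun y => ?_, fun q => ?_⟩, fun y h0 => ?_, fun y q hq => ?_⟩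
  · obtain ⟨N, hN, hNf⟩ := f.locallyFinite y
    refine ⟨hNf.toFinset, ?_⟩
    filter_upwards [hN] with z hz q hq
    exact hNf.mem_toFinset.2 ⟨z, hφ z q hq, hz⟩
  · exact continuous_real_toNNReal.comp (f q).continuous
  · obtain ⟨q, hq⟩ := f.exists_pos (Set.mem_univ y)
    have : (f q y).toNNReal = 0 := DFunLike.congr_fun h0 q
    exact (Real.toNNReal_pos.2 hq).ne' this
  · exact hf q (subset_closure (hφ y q hq))

lemma exists_inter_label {Y Q : Type} [Nonempty Q] {U : Q → Set Y}
    (hinter : ∀ a b, (U a ∩ U b).Nonempty → ∃ c, U c = U a ∩ U b) :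
    ∃ γ : Finset Q → Q, ∀ S : Finset Q, S.Nonempty → ∀ y, (∀ s ∈ S, y ∈ U s) →
      U (γ S) = ⋂ s ∈ S, U s := by
  classical
  have key (S : Finset Q) (hS : S.Nonempty) : ∀ y, (∀ s ∈ S, y ∈ U s) →
      ∃ c, U c = ⋂ s ∈ S, U s := by
    induction hS using Finset.Nonempty.cons_induction with
    | singleton a => exact fun y _ => ⟨a, by simp⟩
    | cons a S ha hS ih =>
      intro y hy
      simp only [Finset.forall_mem_cons] at hy
      obtain ⟨c, hc⟩ := ih y hy.2
      obtain ⟨d, hd⟩ := hinter a c ⟨y, hy.1, hc ▸ Set.mem_iInter₂.2 hy.2⟩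
      refine ⟨d, ?_⟩
      rw [hd, hc, Finset.cons_eq_insert, Finset.set_biInter_insert]
  refine ⟨fun S => if h : ∃ c, U c = ⋂ s ∈ S, U s then h.choose else Classical.arbitrary Q,
    fun S hS y hy => ?_⟩
  have h := key S hS y hy
  beta_reduce
  rw [dif_pos h]
  exact h.choose_spec

lemma ChainWeight.homotopic_of_normalize {Q : Type} [PartialOrder Q]
    {ψ : unitInterval → ChainWeight Q → Q →₀ ℝ≥0}
    (hψ : ∀ (n : ℕ) (σ : Fin (n + 1) →o Q),
      LocFinCont fun z : stdSimplex ℝ (Fin (n + 1)) × unitInterval => ψ z.2 (ofSimplex σ z.1))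
    (hne : ∀ τ w, ψ τ w ≠ 0) (hc : ∀ τ w, IsChain (· ≤ ·) ((ψ τ w).support : Set Q))
    {k k' : C(ChainWeight Q, ChainWeight Q)} (hk : ∀ w, normalize _ (hne 0 w) (hc 0 w) = k w)
    (hk' : ∀ w, normalize _ (hne 1 w) (hc 1 w) = k' w) : k.Homotopic k' := by
  have hK : Continuous fun z : ChainWeight Q × unitInterval =>
      normalize (ψ z.2 z.1) (hne z.2 z.1) (hc z.2 z.1) :=
    continuous_of_ofSimplex_prod fun n σ => continuous_normalize (hψ n σ)
      (fun z => hne z.2 (ofSimplex σ z.1)) fun z => hc z.2 (ofSimplex σ z.1)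
  exact ⟨⟨⟨_, hK.comp continuous_swap⟩, hk, hk'⟩⟩

/-- A space with a suitable cover by contractible open sets is homotopy equivalent to the
order complex of the cover. -/
lemma nonempty_homotopyEquiv_chainWeight {Y Q : Type} [TopologicalSpace Y] [ParacompactSpace Y]
    [T2Space Y] [PartialOrder Q] {U : Q → Set Y} (hopen : ∀ q, IsOpen (U q))
    (hcover : ∀ y, ∃ q, y ∈ U q) (hle : ∀ q r, U q ⊆ U r ↔ q ≤ r)
    (hinter : ∀ a b, (U a ∩ U b).Nonempty → ∃ c, U c = U a ∩ U b)
    (hcontr : ∀ q, ContractibleSpace (U q)) :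
    Nonempty (ContinuousMap.HomotopyEquiv Y (ChainWeight Q)) := by
  rcases isEmpty_or_nonempty Q with hQ | hQ
  · have : IsEmpty Y := ⟨fun y => hQ.elim (hcover y).choose⟩
    have : IsEmpty (ChainWeight Q) := ⟨fun w => hQ.elim w.support_nonempty.choose⟩
    exact ⟨(Homeomorph.empty : Y ≃ₜ ChainWeight Q).toHomotopyEquiv⟩
  have hmono : Monotone U := fun q r h => (hle q r).2 h
  choose h p hU using fun q => exists_isContraction (U q)
  have hne : ∀ q, (U q).Nonempty := fun q => ⟨p q, (hU q).mem⟩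
  obtain ⟨γ, hγ⟩ := exists_inter_label hinter
  obtain ⟨φ, hφ, hφne, hφU⟩ := exists_partition_weight hopen hcover
  have hnz (w : ChainWeight Q) : w.weight ≠ 0 := Finsupp.support_nonempty_iff.1 w.support_nonempty
  let f : C(Y, ChainWeight Q) :=
    ⟨fun y => ChainWeight.normalize (subdivide γ (φ y)) (subdivide_ne_zero γ (hφne y))
      (isChain_support_subdivide hγ hle (hφU y)),
      ChainWeight.continuous_normalize (hφ.subdivide γ) _ _⟩
  have hfU (y : Y) (q : Q) (hq : q ∈ (f y).weight.support) : y ∈ U q :=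
    mem_of_mem_support_subdivide hγ (hφU y) (Finsupp.support_smul hq)
  have hf : LocFinCont fun y => (f y).weight :=
    ChainWeight.locFinCont_normalize (hφ.subdivide γ) (fun y => subdivide_ne_zero γ (hφne y))
      fun y => isChain_support_subdivide hγ hle (hφU y)
  let g₀ : ChainWeight Q → Y := fun w => supportFlow h w.weight (p w.support_nonempty.choose) 0
  have hg₀ : Continuous g₀ := by
    rw [ChainWeight.continuous_iff]
    intro n σ
    exact continuous_supportFlow hU hmono hopen (ChainWeight.locFinCont_ofSimplex σ)
      (fun t => (ChainWeight.ofSimplex σ t).isChain) continuous_const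
      (fun _ h => absurd rfl h) (fun _ h => absurd rfl h) fun t => Or.inr (hnz _)
  let g : C(ChainWeight Q, Y) := ⟨g₀, hg₀⟩
  have hgU (w : ChainWeight Q) (q : Q) (hq : q ∈ (excess w.weight).support) : g w ∈ U q := by
    have hq' := support_excess_subset _ hq
    exact flow_mem hU hmono (chainList_pairwise _) (fun h => absurd rfl h)
      ((mem_chainList w.isChain).2 hq') (Finsupp.mem_support_iff.1 hq')
      fun q' _ hlt => lt_of_mem_support_excess hq hlt
  have hgf : (g.comp f).Homotopic (ContinuousMap.id Y) := by
    have hc (z : unitInterval × Y) :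
        IsChain (· ≤ ·) ((unitInterval.toNNReal z.1 • (f z.2).weight).support : Set Q) :=
      (f z.2).isChain.mono (Finset.coe_subset.2 Finsupp.support_smul)
    refine ContinuousMap.Homotopic.symm ⟨⟨⟨fun z => supportFlow h
      (unitInterval.toNNReal z.1 • (f z.2).weight) z.2
      (unitInterval.toNNReal (unitInterval.symm z.1)), ?_⟩, fun y => ?_, fun y => ?_⟩⟩
    · refine continuous_supportFlow hU hmono hopen
        ((hf.comp continuous_snd).smul (by fun_prop)) hc (by fun_prop)
        (fun z _ => continuous_snd.continuousAt)
        (fun z _ q hq => hfU z.2 q (Finsupp.support_smul hq)) fun z => ?_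
      by_contra! h0
      have h1 : (1 - z.1 : ℝ) = 0 := congr_arg NNReal.toReal h0.1
      have h2 : (z.1 : ℝ) = 0 :=
        congr_arg NNReal.toReal ((smul_eq_zero.1 h0.2).resolve_right (hnz _))
      rw [h2] at h1
      norm_num at h1
    · refine flow_eq_self hU fun q _ => ?_
      have h0 : unitInterval.toNNReal 0 = 0 := rfl
      simp [h0]
    · have h0 : unitInterval.toNNReal 0 = 0 := rfl
      have h1 : unitInterval.toNNReal 1 = 1 := rfl
      change supportFlow h (unitInterval.toNNReal 1 • (f y).weight) y
        (unitInterval.toNNReal (unitInterval.symm 1)) = supportFlow h (f y).weight _ 0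
      rw [unitInterval.symm_one, h0, h1, one_smul]
      exact supportFlow_start hU (hnz _) (f y).isChain _ _
  have hfg : (f.comp g).Homotopic (ContinuousMap.id (ChainWeight Q)) := by
    have hW (w : ChainWeight Q) : excess w.weight ≠ 0 := excess_ne_zero (hnz w)
    have hWchain (w : ChainWeight Q) : IsChain (· ≤ ·) ((excess w.weight).support : Set Q) :=
      w.isChain.mono (Finset.coe_subset.2 (support_excess_subset _))
    have hmixU (z : unitInterval × ChainWeight Q) (q : Q)
        (hq : q ∈ (mix z.1 (excess z.2.weight) (φ (g z.2))).support) : g z.2 ∈ U q :=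
      (mem_support_mix hq).elim (hgU z.2 q) (hφU _ q)
    have hsub (w : ChainWeight Q) :
        (subdivide γ (excess w.weight)).support ⊆ w.weight.support :=
      (support_subdivide_subset hγ hle hne (hWchain w)).trans (support_excess_subset _)
    have hsubchain (w : ChainWeight Q) := w.isChain.mono (Finset.coe_subset.2 (hsub w))
    let k : ChainWeight Q → ChainWeight Q := fun w => ChainWeight.normalize
      (subdivide γ (excess w.weight)) (subdivide_ne_zero γ (hW w)) (hsubchain w)
    have hk : Continuous k := by
      rw [ChainWeight.continuous_iff]
      intro n σ
      exact ChainWeight.continuous_normalize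
        ((ChainWeight.locFinCont_ofSimplex σ).excess.subdivide γ) _ _
    have hfst {n : ℕ} (σ : Fin (n + 1) →o Q) :
        LocFinCont fun z : stdSimplex ℝ (Fin (n + 1)) × unitInterval =>
          (ChainWeight.ofSimplex σ z.1).weight :=
      (ChainWeight.locFinCont_ofSimplex σ).comp continuous_fst
    have h1 : (⟨k, hk⟩ : C(ChainWeight Q, ChainWeight Q)).Homotopic (f.comp g) :=
      ChainWeight.homotopic_of_normalize
        (ψ := fun τ w => subdivide γ (mix τ (excess w.weight) (φ (g w))))
        (fun n σ => ((hfst σ).excess.mix (hφ.comp (g.continuous.comp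
          ((ChainWeight.continuous_ofSimplex σ).comp continuous_fst))) continuous_snd).subdivide γ)
        (fun τ w => subdivide_ne_zero γ (mix_ne_zero τ (hW w) (hφne (g w))))
        (fun τ w => isChain_support_subdivide hγ hle (hmixU (τ, w)))
        (fun w => ChainWeight.normalize_congr (hw' := subdivide_ne_zero γ (hW w))
          (hc' := hsubchain w) (by rw [mix_zero]))
        fun w => ChainWeight.normalize_congr (hw' := subdivide_ne_zero γ (hφne (g w)))
          (hc' := isChain_support_subdivide hγ hle (hφU (g w))) (by rw [mix_one])
    have h2 : (ContinuousMap.id (ChainWeight Q)).Homotopic ⟨k, hk⟩ :=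
      ChainWeight.homotopic_of_normalize
        (ψ := fun τ w => mix τ w.weight (subdivide γ (excess w.weight)))
        (fun n σ => (hfst σ).mix ((hfst σ).excess.subdivide γ) continuous_snd)
        (fun τ w => mix_ne_zero τ (hnz w) (subdivide_ne_zero γ (hW w)))
        (fun τ w => w.isChain.mono fun q hq =>
          (mem_support_mix hq).elim id fun h => hsub w h)
        (fun w => ChainWeight.normalize_eq (mix_zero _ _))
        fun w => ChainWeight.normalize_congr (hw' := subdivide_ne_zero γ (hW w))
          (hc' := hsubchain w) (mix_one _ _)
    exact (h2.trans h1).symm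
  exact ⟨⟨f, g, hgf, hfg⟩⟩

end NerveTheorem

/-- **Weil's theorem.** If `Y` is a locally contractible paracompact Hausdorff space and
`(V α)` is a locally finite open covering closed under finite nonempty intersections, all of
whose members are contractible, then `Y` is homotopy equivalent to the classifying space
`|B𝔙|` of the covering category. -/
theorem weil_covering_homotopy_equivalence
    {Y : Type} [TopologicalSpace Y] [ParacompactSpace Y] [T2Space Y]
    (hloc : ∀ y : Y, ∀ W ∈ nhds y, ∃ V' ∈ nhds y, V' ⊆ W ∧ ContractibleSpace V')
    {A : Type} (V : A → Set Y)
    (hopen : ∀ α, IsOpen (V α))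
    (hcover : ∀ y : Y, ∃ α, y ∈ V α)
    (hlocfin : LocallyFinite V)
    (hinter : ∀ α β, (V α ∩ V β).Nonempty → ∃ γ, V γ = V α ∩ V β)
    (hcontr : ∀ α, ContractibleSpace (V α)) :
    Nonempty (ContinuousMap.HomotopyEquiv Y
      (SSet.toTop.obj (@nerve A (coverCategory V)))) := by
  let _ : Category A := coverCategory V
  have : Quiver.IsThin A := fun a b => inferInstanceAs (Subsingleton (PLift (V a ⊆ V b)))
  obtain ⟨e⟩ := NerveTheorem.nonempty_homotopyEquiv_nerve (C := A) (Q := Set.range V)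
    (v := Set.rangeFactorization V) (fun a b => ⟨fun ⟨g⟩ => PLift.down g, fun h => ⟨PLift.up h⟩⟩)
    Set.rangeFactorization_surjective
  obtain ⟨e'⟩ := NerveTheorem.nonempty_homotopyEquiv_chainWeight (Q := Set.range V)
    (U := Subtype.val) (by rintro ⟨_, a, rfl⟩; exact hopen a)
    (fun y => (hcover y).elim fun a ha => ⟨⟨V a, a, rfl⟩, ha⟩) (fun _ _ => Iff.rfl)
    (by
      rintro ⟨_, a, rfl⟩ ⟨_, b, rfl⟩ hab
      obtain ⟨c, hc⟩ := hinter a b hab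
      exact ⟨⟨V c, c, rfl⟩, hc⟩)
    (by rintro ⟨_, a, rfl⟩; exact hcontr a)
  exact ⟨(e'.trans (NerveTheorem.ChainWeight.realizationHomeomorph
    (Set.range V)).symm.toHomotopyEquiv).trans e.symm⟩
end

section
/- Let L and L' be unimodular symplectic lattices, let I ⊆ L and I' ⊆ L' be primitive isotropic sublattices, and let φ : L → L' be an isomorphism of symplectic lattices with φ(I) ⊆ I'. Then: (a) I ⊆ φ⁻¹(I') ⊆ I^⊥, and the image J of φ⁻¹(I') in I^⊥/I is a primitive isotropic sublattice of the unimodular symplectic lattice I^⊥/I (equipped with the form induced by that of L); and (b) φ induces an isomorphism of symplectic lattices from J^⊥/J (the perpendicular J^⊥ being taken inside I^⊥/I) onto I'^⊥/I'. -/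
section Machinery

variable {R : Type} [CommRing R] {M : Type} [AddCommGroup M] [Module R M]

/-- The `ω`-perpendicular of a submodule `I`: `I^⊥ = {x | ω(x,y) = 0 for all y ∈ I}`. -/
def perp (ω : M →ₗ[R] M →ₗ[R] R) (I : Submodule R M) : Submodule R M where
  carrier := {x | ∀ y ∈ I, ω x y = 0}
  zero_mem' := by intro y _; simp
  add_mem' := by
    intro a b ha hb y hy
    simp [map_add, LinearMap.add_apply, ha y hy, hb y hy]
  smul_mem' := by
    intro c a ha y hy
    simp [map_smul, LinearMap.smul_apply, ha y hy]

/-- `I` viewed as a submodule of `I^⊥`. -/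
abbrev perpSub (ω : M →ₗ[R] M →ₗ[R] R) (I : Submodule R M) : Submodule R (perp ω I) :=
  I.comap (perp ω I).subtype

/-- The subquotient `I^⊥/I`. -/
abbrev SubQuot (ω : M →ₗ[R] M →ₗ[R] R) (I : Submodule R M) :=
  perp ω I ⧸ perpSub ω I

theorem skew_of_alt (ω : M →ₗ[R] M →ₗ[R] R) (halt : ∀ x, ω x x = 0) (x y : M) :
    ω x y = - ω y x := by
  have h := halt (x + y)
  simp only [map_add, LinearMap.add_apply] at h
  rw [halt x, halt y] at h
  linear_combination h

/-- The form induced by an alternating form `ω` on the subquotient `I^⊥/I`. -/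
def inducedForm (ω : M →ₗ[R] M →ₗ[R] R) (I : Submodule R M) (halt : ∀ x, ω x x = 0) :
    SubQuot ω I →ₗ[R] SubQuot ω I →ₗ[R] R :=
  Submodule.liftQ (perpSub ω I)
    { toFun := fun x => Submodule.liftQ (perpSub ω I) ((ω x.1).comp (perp ω I).subtype)
        (by
          intro y hy
          simp only [LinearMap.mem_ker, LinearMap.comp_apply, Submodule.subtype_apply]
          exact x.2 y.1 hy)
      map_add' := by
        intro x y
        refine Submodule.linearMap_qext _ ?_
        ext z
        simp [map_add]
      map_smul' := by
        intro c x
        refine Submodule.linearMap_qext _ ?_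
        ext z
        simp [map_smul] }
    (by
      intro x hx
      simp only [LinearMap.mem_ker]
      refine Submodule.linearMap_qext _ ?_
      ext z
      simp only [LinearMap.coe_comp, Function.comp_apply, Submodule.mkQ_apply,
        Submodule.liftQ_apply, LinearMap.coe_mk, AddHom.coe_mk, LinearMap.comp_apply,
        Submodule.subtype_apply, LinearMap.zero_comp, LinearMap.zero_apply]
      rw [skew_of_alt ω halt, z.2 x.1 hx]
      ring)

@[simp] theorem inducedForm_mk_mk (ω : M →ₗ[R] M →ₗ[R] R) (I : Submodule R M)
    (halt : ∀ x, ω x x = 0) (x y : perp ω I) :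
    inducedForm ω I halt (Submodule.Quotient.mk x) (Submodule.Quotient.mk y) =
      ω x.1 y.1 := by
  simp [inducedForm]

theorem inducedForm_alt (ω : M →ₗ[R] M →ₗ[R] R) (I : Submodule R M)
    (halt : ∀ x, ω x x = 0) : ∀ v, inducedForm ω I halt v v = 0 := by
  intro v
  obtain ⟨x, rfl⟩ := Submodule.mkQ_surjective _ v
  rw [Submodule.mkQ_apply, inducedForm_mk_mk]
  exact halt x.1

/-- The image in `I^⊥/I` of a submodule `N` of `M` (more precisely, of `N ∩ I^⊥`). -/
def imageInSubQuot (ω : M →ₗ[R] M →ₗ[R] R) (I : Submodule R M) (N : Submodule R M) :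
    Submodule R (SubQuot ω I) :=
  (N.comap (perp ω I).subtype).map (perpSub ω I).mkQ

/-- The quotient map `I^⊥ → I^⊥/I`. -/
def mkSubQuot (ω : M →ₗ[R] M →ₗ[R] R) (I : Submodule R M) (x : perp ω I) : SubQuot ω I :=
  (perpSub ω I).mkQ x

/-- The orthogonal complement `N^⊥` inside `I^⊥/I` of a submodule `N ⊆ I^⊥/I`,
with respect to the induced form. -/
abbrev perpInSubQuot (ω : M →ₗ[R] M →ₗ[R] R) (I : Submodule R M) (halt : ∀ x, ω x x = 0)
    (N : Submodule R (SubQuot ω I)) : Submodule R (SubQuot ω I) :=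
  perp (inducedForm ω I halt) N

/-- The iterated subquotient `N^⊥/N` of `I^⊥/I`. -/
abbrev SubQuot₂ (ω : M →ₗ[R] M →ₗ[R] R) (I : Submodule R M) (halt : ∀ x, ω x x = 0)
    (N : Submodule R (SubQuot ω I)) :=
  SubQuot (inducedForm ω I halt) N

/-- The form induced on the iterated subquotient `N^⊥/N`. -/
noncomputable def inducedForm₂ (ω : M →ₗ[R] M →ₗ[R] R) (I : Submodule R M)
    (halt : ∀ x, ω x x = 0) (N : Submodule R (SubQuot ω I)) :
    SubQuot₂ ω I halt N →ₗ[R] SubQuot₂ ω I halt N →ₗ[R] R :=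
  inducedForm (inducedForm ω I halt) N (inducedForm_alt ω I halt)

/-- The quotient map `N^⊥ → N^⊥/N` for the iterated subquotient. -/
def mkSubQuot₂ (ω : M →ₗ[R] M →ₗ[R] R) (I : Submodule R M) (halt : ∀ x, ω x x = 0)
    (N : Submodule R (SubQuot ω I)) (u : perpInSubQuot ω I halt N) : SubQuot₂ ω I halt N :=
  mkSubQuot (inducedForm ω I halt) N u

/-- The quotient `(I^⊥/I) ⧸ N`. -/
abbrev SubQuotMod (ω : M →ₗ[R] M →ₗ[R] R) (I : Submodule R M)
    (N : Submodule R (SubQuot ω I)) :=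
  SubQuot ω I ⧸ N

end Machinery

section Unimodular

/-- Primitivity in a `ℤ`-module does not depend on whether the scalar multiplication on the
quotient comes from the module structure or from the group structure. -/
theorem noZeroSMulDivisors_zsmul_quotient_iff {A : Type} [AddCommGroup A] {inst : Module ℤ A}
    (N : Submodule ℤ A) :
    @NoZeroSMulDivisors ℤ (A ⧸ N) _ _ SubNegMonoid.toZSMul.toSMul ↔
      @NoZeroSMulDivisors ℤ (A ⧸ N) _ _ (Submodule.Quotient.instSMul N) := by
  rw [show SubNegMonoid.toZSMul.toSMul = Submodule.Quotient.instSMul N from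
    congrArg (fun m : Module ℤ (A ⧸ N) => m.toSMul)
      (Subsingleton.elim (AddCommGroup.toIntModule (A ⧸ N)) (Submodule.Quotient.module N))]

variable {R : Type} [CommRing R] {M : Type} [AddCommGroup M] [Module R M]

theorem noZeroSMulDivisors_quotient_iff (N : Submodule R M) :
    NoZeroSMulDivisors R (M ⧸ N) ↔ ∀ (r : R) (x : M), r • x ∈ N → r = 0 ∨ x ∈ N := by
  refine ⟨fun h r x hx => ?_, fun h => ⟨fun {r v} hv => ?_⟩⟩
  · have hrx : r • (Submodule.Quotient.mk x : M ⧸ N) = 0 := by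
      rw [← Submodule.Quotient.mk_smul]
      exact (Submodule.Quotient.mk_eq_zero N).2 hx
    exact (eq_zero_or_eq_zero_of_smul_eq_zero hrx).imp_right (Submodule.Quotient.mk_eq_zero N).1
  · obtain ⟨x, rfl⟩ := Submodule.Quotient.mk_surjective N v
    rw [← Submodule.Quotient.mk_smul] at hv
    exact (h r x ((Submodule.Quotient.mk_eq_zero N).1 hv)).imp_right
      (Submodule.Quotient.mk_eq_zero N).2

theorem noZeroSMulDivisors_quotient_perp [NoZeroDivisors R] (ω : M →ₗ[R] M →ₗ[R] R)
    (I : Submodule R M) : NoZeroSMulDivisors R (M ⧸ perp ω I) := by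
  rw [noZeroSMulDivisors_quotient_iff]
  intro r x hx
  refine or_iff_not_imp_left.2 fun hr y hy => ?_
  have h := hx y hy
  rw [map_smul, LinearMap.smul_apply, smul_eq_mul] at h
  exact (mul_eq_zero.1 h).resolve_left hr

theorem projective_quotient_of_noZeroSMulDivisors [IsDomain R] [IsPrincipalIdealRing R]
    [Module.Finite R M] (N : Submodule R M) [NoZeroSMulDivisors R (M ⧸ N)] :
    Module.Projective R (M ⧸ N) := by
  have : Module.IsTorsionFree R (M ⧸ N) :=
    .of_smul_eq_zero fun _ _ h => eq_zero_or_eq_zero_of_smul_eq_zero h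
  infer_instance

/-- A linear map out of a submodule with projective quotient extends to the whole module. -/
theorem exists_extension_of_projective_quotient {P : Type} [AddCommGroup P] [Module R P]
    (N : Submodule R M) [Module.Projective R (M ⧸ N)] (f : N →ₗ[R] P) :
    ∃ g : M →ₗ[R] P, ∀ x : N, g x = f x := by
  obtain ⟨s, hs⟩ := Module.projective_lifting_property N.mkQ LinearMap.id N.mkQ_surjective
  have hmem (x : M) : (LinearMap.id - s ∘ₗ N.mkQ : M →ₗ[R] M) x ∈ N := by
    have h := LinearMap.congr_fun hs (N.mkQ x)
    refine (Submodule.Quotient.mk_eq_zero N).1 ?_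
    simpa [sub_eq_zero] using h.symm
  refine ⟨f ∘ₗ (LinearMap.id - s ∘ₗ N.mkQ : M →ₗ[R] M).codRestrict N hmem, fun x => ?_⟩
  rw [LinearMap.comp_apply]
  congr 1
  ext
  simp [(Submodule.Quotient.mk_eq_zero N).2 x.2]

/-- A submodule with projective quotient contains its double perpendicular. -/
theorem perp_perp_le (ω : M →ₗ[R] M →ₗ[R] R) (halt : ∀ x, ω x x = 0)
    (huni : Function.Surjective fun x : M => ω x) (I : Submodule R M)
    [Module.Projective R (M ⧸ I)] : perp ω (perp ω I) ≤ I := by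
  intro x hx
  rw [← Submodule.Quotient.mk_eq_zero I, ← Module.forall_dual_apply_eq_zero_iff R]
  intro g
  obtain ⟨y, hy⟩ := huni (g ∘ₗ I.mkQ)
  have hyI : y ∈ perp ω I := fun z hz => by
    simp only at hy
    simp [hy, (Submodule.Quotient.mk_eq_zero I).2 hz]
  have h := hx y hyI
  rw [skew_of_alt ω halt, neg_eq_zero] at h
  simp only at hy
  simpa [hy] using h

theorem inducedForm_bijective [IsDomain R] [IsPrincipalIdealRing R] [Module.Finite R M]
    (ω : M →ₗ[R] M →ₗ[R] R) (halt : ∀ x, ω x x = 0)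
    (huni : Function.Surjective fun x : M => ω x) (I : Submodule R M)
    [NoZeroSMulDivisors R (M ⧸ I)] (hI : I ≤ perp ω I) :
    Function.Bijective fun v : SubQuot ω I => inducedForm ω I halt v := by
  have := projective_quotient_of_noZeroSMulDivisors I
  have := noZeroSMulDivisors_quotient_perp ω I
  have := projective_quotient_of_noZeroSMulDivisors (perp ω I)
  constructor
  · refine (injective_iff_map_eq_zero (inducedForm ω I halt)).2 fun v hv => ?_
    obtain ⟨x, rfl⟩ := Submodule.Quotient.mk_surjective _ v
    refine (Submodule.Quotient.mk_eq_zero _).2 (perp_perp_le ω halt huni I fun y hy => ?_)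
    simpa using LinearMap.congr_fun hv (Submodule.Quotient.mk ⟨y, hy⟩)
  · intro f
    obtain ⟨g, hg⟩ := exists_extension_of_projective_quotient (perp ω I) (f ∘ₗ (perpSub ω I).mkQ)
    obtain ⟨x, hx⟩ := huni g
    simp only at hx
    have hxI : x ∈ perp ω I := fun y hy => by
      have hy0 : (perpSub ω I).mkQ ⟨y, hI hy⟩ = 0 := (Submodule.Quotient.mk_eq_zero _).2 hy
      rw [hx, hg ⟨y, hI hy⟩, LinearMap.comp_apply, hy0, map_zero]
    refine ⟨Submodule.Quotient.mk ⟨x, hxI⟩, ?_⟩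
    refine Submodule.linearMap_qext _ (LinearMap.ext fun y => ?_)
    simpa [hx] using hg y

end Unimodular

section Stages

variable {R : Type} [CommRing R] {M : Type} [AddCommGroup M] [Module R M]
  (ω : M →ₗ[R] M →ₗ[R] R)

theorem mkSubQuot_mem_imageInSubQuot {I N : Submodule R M} (hIN : I ≤ N) (x : perp ω I) :
    mkSubQuot ω I x ∈ imageInSubQuot ω I N ↔ (x : M) ∈ N := by
  refine ⟨?_, fun hx => ⟨x, hx, rfl⟩⟩
  rintro ⟨y, hy, hyx⟩
  have hI : (y - x : M) ∈ I := (Submodule.Quotient.eq (perpSub ω I)).1 hyx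
  simpa using N.sub_mem hy (hIN hI)

theorem noZeroSMulDivisors_subQuotMod {I N : Submodule R M} (hIN : I ≤ N)
    (hN : NoZeroSMulDivisors R (M ⧸ N)) :
    NoZeroSMulDivisors R (SubQuotMod ω I (imageInSubQuot ω I N)) := by
  rw [noZeroSMulDivisors_quotient_iff] at hN ⊢
  intro r v hv
  obtain ⟨x, rfl⟩ := Submodule.mkQ_surjective _ v
  rw [← map_smul] at hv
  exact (hN r x ((mkSubQuot_mem_imageInSubQuot ω hIN (r • x)).1 hv)).imp_right
    (mkSubQuot_mem_imageInSubQuot ω hIN x).2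

theorem inducedForm_eq_zero_of_mem_imageInSubQuot (halt : ∀ x, ω x x = 0) {I N : Submodule R M}
    (hN : ∀ x ∈ N, ∀ y ∈ N, ω x y = 0) {u v : SubQuot ω I} (hu : u ∈ imageInSubQuot ω I N)
    (hv : v ∈ imageInSubQuot ω I N) : inducedForm ω I halt u v = 0 := by
  obtain ⟨x, hx, rfl⟩ := hu
  obtain ⟨y, hy, rfl⟩ := hv
  simpa using hN x hx y hy

theorem mkSubQuot_mem_perpInSubQuot (halt : ∀ x, ω x x = 0) {I N : Submodule R M}
    (hN : N ≤ perp ω I) (x : perp ω I) :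
    mkSubQuot ω I x ∈ perpInSubQuot ω I halt (imageInSubQuot ω I N) ↔ (x : M) ∈ perp ω N := by
  constructor
  · intro h y hy
    simpa [mkSubQuot] using h (mkSubQuot ω I ⟨y, hN hy⟩) ⟨⟨y, hN hy⟩, hy, rfl⟩
  · rintro h _ ⟨y, hy, rfl⟩
    simpa [mkSubQuot] using h y hy

variable {M' : Type} [AddCommGroup M'] [Module R M'] (ω' : M' →ₗ[R] M' →ₗ[R] R)

theorem apply_mem_perp_iff (φ : M ≃ₗ[R] M') (hφ : ∀ x y, ω' (φ x) (φ y) = ω x y)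
    (I' : Submodule R M') (x : M) :
    φ x ∈ perp ω' I' ↔ x ∈ perp ω (I'.comap φ.toLinearMap) := by
  refine ⟨fun h y hy => hφ x y ▸ h (φ y) hy, fun h y hy => ?_⟩
  have := h (φ.symm y) (by simpa using hy)
  rwa [← hφ, φ.apply_symm_apply] at this

/-- An isometry `φ` with `φ(I) ⊆ I'` and `φ⁻¹(I') ⊆ I^⊥` induces an isometry from the iterated
subquotient of `I^⊥/I` by the image of `φ⁻¹(I')` onto `I'^⊥/I'`. -/
theorem exists_subQuot₂_equiv (halt : ∀ x, ω x x = 0) (halt' : ∀ x, ω' x x = 0)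
    {I : Submodule R M} {I' : Submodule R M'} (φ : M ≃ₗ[R] M')
    (hφ : ∀ x y, ω' (φ x) (φ y) = ω x y) (hI : I ≤ I'.comap φ.toLinearMap)
    (hI' : I'.comap φ.toLinearMap ≤ perp ω I) :
    ∃ ψ : SubQuot₂ ω I halt (imageInSubQuot ω I (I'.comap φ.toLinearMap)) ≃+ SubQuot ω' I',
      (∀ u v, inducedForm ω' I' halt' (ψ u) (ψ v) =
        inducedForm₂ ω I halt (imageInSubQuot ω I (I'.comap φ.toLinearMap)) u v) ∧
      ∀ (x : M) (hx : x ∈ perp ω I)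
        (h2 : mkSubQuot ω I ⟨x, hx⟩ ∈
          perpInSubQuot ω I halt (imageInSubQuot ω I (I'.comap φ.toLinearMap)))
        (h3 : φ x ∈ perp ω' I'),
        ψ (mkSubQuot₂ ω I halt (imageInSubQuot ω I (I'.comap φ.toLinearMap))
          ⟨mkSubQuot ω I ⟨x, hx⟩, h2⟩) = mkSubQuot ω' I' ⟨φ x, h3⟩ := by
  set N := I'.comap φ.toLinearMap with hN
  set J := imageInSubQuot ω I N
  have hperp (y : perp ω' I') : φ.symm y ∈ perp ω N := by
    rw [hN, ← apply_mem_perp_iff ω ω' φ hφ, φ.apply_symm_apply]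
    exact y.2
  have hperp' (y : perp ω' I') : φ.symm y ∈ perp ω I := fun z hz => hperp y z (hI hz)
  let f : perp ω' I' →ₗ[R] perp ω I :=
    (φ.symm.toLinearMap ∘ₗ (perp ω' I').subtype).codRestrict (perp ω I) hperp'
  let g : perp ω' I' →ₗ[R] perpInSubQuot ω I halt J :=
    ((perpSub ω I).mkQ ∘ₗ f).codRestrict _
      fun y => (mkSubQuot_mem_perpInSubQuot ω halt hI' (f y)).2 (hperp y)
  let h : perp ω' I' →ₗ[R] SubQuot₂ ω I halt J := (perpSub (inducedForm ω I halt) J).mkQ ∘ₗ g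
  have hker : LinearMap.ker h = perpSub ω' I' := by
    ext y
    calc h y = 0 ↔ mkSubQuot ω I (f y) ∈ J := Submodule.Quotient.mk_eq_zero _
      _ ↔ φ.symm y ∈ N := mkSubQuot_mem_imageInSubQuot ω hI (f y)
      _ ↔ (y : M') ∈ I' := by simp [hN]
  have hmk (x : M) (hx : x ∈ perp ω I) (h2 : mkSubQuot ω I ⟨x, hx⟩ ∈ perpInSubQuot ω I halt J)
      (h3 : φ x ∈ perp ω' I') :
      h ⟨φ x, h3⟩ = mkSubQuot₂ ω I halt J ⟨mkSubQuot ω I ⟨x, hx⟩, h2⟩ := by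
    have hf : f ⟨φ x, h3⟩ = ⟨x, hx⟩ := Subtype.ext (φ.symm_apply_apply x)
    have hg : g ⟨φ x, h3⟩ = ⟨mkSubQuot ω I ⟨x, hx⟩, h2⟩ :=
      Subtype.ext (congrArg (mkSubQuot ω I) hf)
    exact congrArg (mkSubQuot₂ ω I halt J) hg
  have hsurj : Function.Surjective h := by
    intro u
    obtain ⟨⟨v, hv⟩, rfl⟩ := Submodule.mkQ_surjective _ u
    obtain ⟨x, rfl⟩ := Submodule.mkQ_surjective _ v
    have h3 := (apply_mem_perp_iff ω ω' φ hφ I' x).2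
      ((mkSubQuot_mem_perpInSubQuot ω halt hI' x).1 hv)
    exact ⟨⟨φ x, h3⟩, hmk x x.2 hv h3⟩
  let e : SubQuot ω' I' ≃ₗ[R] SubQuot₂ ω I halt J :=
    (Submodule.quotEquivOfEq _ _ hker.symm).trans (h.quotKerEquivOfSurjective hsurj)
  have he (y : perp ω' I') : e (mkSubQuot ω' I' y) = h y := rfl
  have he' (u : SubQuot ω' I') : e.symm.toAddEquiv (e u) = u := e.symm_apply_apply u
  refine ⟨e.symm.toAddEquiv, fun u v => ?_, fun x hx h2 h3 => ?_⟩
  · obtain ⟨u, rfl⟩ := e.surjective u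
    obtain ⟨v, rfl⟩ := e.surjective v
    obtain ⟨x, rfl⟩ := Submodule.mkQ_surjective _ u
    obtain ⟨y, rfl⟩ := Submodule.mkQ_surjective _ v
    rw [he', he']
    calc inducedForm ω' I' halt' (mkSubQuot ω' I' x) (mkSubQuot ω' I' y)
        = ω' x y := inducedForm_mk_mk ω' I' halt' x y
      _ = ω (φ.symm x) (φ.symm y) := by simp [← hφ]
      _ = inducedForm ω I halt (g x) (g y) := (inducedForm_mk_mk ω I halt (f x) (f y)).symm
      _ = inducedForm₂ ω I halt J (h x) (h y) := (inducedForm_mk_mk _ _ _ (g x) (g y)).symm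
  · rw [← hmk x hx h2 h3, ← he, he']

end Stages

/-- Let `L, L'` be unimodular symplectic lattices, `I ⊆ L`, `I' ⊆ L'` primitive isotropic
sublattices, and `φ : L ≅ L'` an isomorphism of symplectic lattices with `φ(I) ⊆ I'`. Then
(a) `I ⊆ φ⁻¹(I') ⊆ I^⊥`, the image `J` of `φ⁻¹(I')` in `I^⊥/I` is a primitive isotropic
sublattice of the unimodular symplectic lattice `I^⊥/I` (with the induced form), and
(b) `φ` induces an isomorphism of symplectic lattices `J^⊥/J ≅ I'^⊥/I'`. -/
theorem symplectic_lattice_subquotient_isomorphism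
    {L L' : Type} [AddCommGroup L] [Module ℤ L] [Module.Free ℤ L] [Module.Finite ℤ L]
    [AddCommGroup L'] [Module ℤ L'] [Module.Free ℤ L'] [Module.Finite ℤ L']
    (ω : L →ₗ[ℤ] L →ₗ[ℤ] ℤ) (ω' : L' →ₗ[ℤ] L' →ₗ[ℤ] ℤ)
    (halt : ∀ x, ω x x = 0) (halt' : ∀ x, ω' x x = 0)
    (huni : Function.Bijective fun x : L => ω x)
    (huni' : Function.Bijective fun x : L' => ω' x)
    (I : Submodule ℤ L) (I' : Submodule ℤ L')
    (hIprim : NoZeroSMulDivisors ℤ (L ⧸ I)) (hI'prim : NoZeroSMulDivisors ℤ (L' ⧸ I'))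
    (hIiso : ∀ x ∈ I, ∀ y ∈ I, ω x y = 0) (hI'iso : ∀ x ∈ I', ∀ y ∈ I', ω' x y = 0)
    (φ : L ≃ₗ[ℤ] L') (hφ : ∀ x y, ω' (φ x) (φ y) = ω x y)
    (hφI : I.map φ.toLinearMap ≤ I') :
    -- (a)
    I ≤ I'.comap φ.toLinearMap ∧
    I'.comap φ.toLinearMap ≤ perp ω I ∧
    -- `I^⊥/I` is again a unimodular symplectic lattice
    (∀ v, inducedForm ω I halt v v = 0) ∧
    Function.Bijective (fun v : SubQuot ω I => inducedForm ω I halt v) ∧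
    -- `J` is a primitive isotropic sublattice of `I^⊥/I`
    NoZeroSMulDivisors ℤ (SubQuotMod ω I (imageInSubQuot ω I (I'.comap φ.toLinearMap))) ∧
    (∀ u ∈ imageInSubQuot ω I (I'.comap φ.toLinearMap), ∀ v ∈ imageInSubQuot ω I (I'.comap φ.toLinearMap), inducedForm ω I halt u v = 0) ∧
    -- (b) `φ` induces an isomorphism of symplectic lattices `J^⊥/J ≅ I'^⊥/I'`
    ∃ ψ : SubQuot₂ ω I halt (imageInSubQuot ω I (I'.comap φ.toLinearMap)) ≃+ SubQuot ω' I',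
      (∀ u v, inducedForm ω' I' halt' (ψ u) (ψ v) =
        inducedForm₂ ω I halt (imageInSubQuot ω I (I'.comap φ.toLinearMap)) u v) ∧
      ∀ (x : L) (hx : x ∈ perp ω I)
        (h2 : mkSubQuot ω I ⟨x, hx⟩ ∈ perpInSubQuot ω I halt (imageInSubQuot ω I (I'.comap φ.toLinearMap)))
        (h3 : φ x ∈ perp ω' I'),
        ψ (mkSubQuot₂ ω I halt (imageInSubQuot ω I (I'.comap φ.toLinearMap)) ⟨mkSubQuot ω I ⟨x, hx⟩, h2⟩) =
          mkSubQuot ω' I' ⟨φ x, h3⟩ := by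
  have hIN : I ≤ I'.comap φ.toLinearMap := Submodule.map_le_iff_le_comap.1 hφI
  have hNiso : ∀ x ∈ I'.comap φ.toLinearMap, ∀ y ∈ I'.comap φ.toLinearMap, ω x y = 0 :=
    fun x hx y hy => hφ x y ▸ hI'iso (φ x) hx (φ y) hy
  have hNI : I'.comap φ.toLinearMap ≤ perp ω I := fun x hx y hy => hNiso x hx y (hIN hy)
  have hN : NoZeroSMulDivisors ℤ (L ⧸ I'.comap φ.toLinearMap) := by
    rw [noZeroSMulDivisors_zsmul_quotient_iff] at hI'prim ⊢
    rw [noZeroSMulDivisors_quotient_iff] at hI'prim ⊢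
    exact fun r x hx => hI'prim r (φ x) (by simpa using hx)
  rw [noZeroSMulDivisors_zsmul_quotient_iff] at hIprim hN
  obtain ⟨ψ, hψ, hψmk⟩ := exists_subQuot₂_equiv ω ω' halt halt' φ hφ hIN hNI
  exact ⟨hIN, hNI, inducedForm_alt ω I halt,
    inducedForm_bijective ω halt huni.surjective I hIiso,
    (noZeroSMulDivisors_zsmul_quotient_iff _).2
      (noZeroSMulDivisors_subQuotMod ω hIN hN),
    fun u hu v hv => inducedForm_eq_zero_of_mem_imageInSubQuot ω halt hNiso hu hv,
    ψ, hψ, hψmk⟩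
end

section
/- Let (V, ω) be a real symplectic vector space of dimension 2g, let V_ℂ = V ⊗_ℝ ℂ be its complexification with complex conjugation v ↦ v̄ and with ω extended ℂ-bilinearly. Let F ⊆ V_ℂ be a complex subspace of complex dimension g such that ω vanishes identically on F × F and such that √−1·ω(v, v̄) > 0 for every nonzero v ∈ F. Let I ⊆ V be an isotropic real subspace, I^⊥ its ω-perpendicular in V, and let ω̄ denote the symplectic form induced by ω on I^⊥/I. Then the image F' of F ∩ (I^⊥)_ℂ under the projection (I^⊥)_ℂ → (I^⊥/I)_ℂ is a complex subspace of complex dimension g − dim_ℝ I, ω̄ (extended ℂ-bilinearly) vanishes identically on F' × F', and √−1·ω̄(w, w̄) > 0 for every nonzero w ∈ F'. -/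
open scoped TensorProduct

/-- Complex conjugation `v ↦ v̄` on the complexification `ℂ ⊗[ℝ] V` of a real
vector space `V`. -/
noncomputable def conjTensor (V : Type) [AddCommGroup V] [Module ℝ V] :
    ℂ ⊗[ℝ] V →ₗ[ℝ] ℂ ⊗[ℝ] V :=
  TensorProduct.map Complex.conjAe.toLinearMap LinearMap.id

section BaseChange

variable {R A M : Type} [CommRing R] [CommRing A] [Algebra R A] [AddCommGroup M] [Module R M]

theorem baseChange_skew_of_alt (ω : M →ₗ[R] M →ₗ[R] R) (halt : ∀ x, ω x x = 0)
    (x y : A ⊗[R] M) :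
    LinearMap.BilinForm.baseChange A ω x y = - LinearMap.BilinForm.baseChange A ω y x := by
  induction x with
  | zero => simp
  | add x₁ x₂ h₁ h₂ => simp only [map_add, LinearMap.add_apply, h₁, h₂]; ring
  | tmul a m =>
    induction y with
    | zero => simp
    | add y₁ y₂ h₁ h₂ => simp only [map_add, LinearMap.add_apply, h₁, h₂]; ring
    | tmul b n =>
      rw [LinearMap.BilinForm.baseChange_tmul, LinearMap.BilinForm.baseChange_tmul,
        skew_of_alt ω halt m n, neg_smul, mul_comm]

theorem baseChange_inducedForm_mkQ (ω : M →ₗ[R] M →ₗ[R] R) (I : Submodule R M)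
    (halt : ∀ x, ω x x = 0) (x y : A ⊗[R] perp ω I) :
    LinearMap.BilinForm.baseChange A (inducedForm ω I halt)
        ((perpSub ω I).mkQ.baseChange A x) ((perpSub ω I).mkQ.baseChange A y) =
      LinearMap.BilinForm.baseChange A ω
        ((perp ω I).subtype.baseChange A x) ((perp ω I).subtype.baseChange A y) := by
  induction x with
  | zero => simp
  | add x₁ x₂ h₁ h₂ => simp only [map_add, LinearMap.add_apply, h₁, h₂]
  | tmul a m =>
    induction y with
    | zero => simp
    | add y₁ y₂ h₁ h₂ => simp only [map_add, h₁, h₂]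
    | tmul b n => rfl

/-- The base change of a form vanishing on `S × T` vanishes on `S_A × T_A`. -/
theorem baseChange_apply_eq_zero (ω : M →ₗ[R] M →ₗ[R] R) {S T : Submodule R M}
    (h : ∀ x ∈ S, ∀ y ∈ T, ω x y = 0) (x : A ⊗[R] S) (y : A ⊗[R] T) :
    LinearMap.BilinForm.baseChange A ω (S.subtype.baseChange A x) (T.subtype.baseChange A y) =
      0 := by
  induction x with
  | zero => simp
  | add x₁ x₂ h₁ h₂ => simp only [map_add, LinearMap.add_apply, h₁, h₂, add_zero]
  | tmul a m =>
    induction y with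
    | zero => simp
    | add y₁ y₂ h₁ h₂ => simp only [map_add, h₁, h₂, add_zero]
    | tmul b n => simp [h m m.2 n n.2]

end BaseChange

section Field

variable {K L V : Type} [Field K] [Field L] [Algebra K L] [AddCommGroup V] [Module K V]

theorem baseChange_subtype_injective (W : Submodule K V) :
    Function.Injective (W.subtype.baseChange L) :=
  Module.Flat.lTensor_preserves_injective_linearMap _ W.injective_subtype

theorem finrank_range_baseChange_subtype (W : Submodule K V) :
    Module.finrank L (LinearMap.range (W.subtype.baseChange L)) = Module.finrank K W := by
  rw [LinearMap.finrank_range_of_inj (baseChange_subtype_injective W), Module.finrank_baseChange]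

theorem perp_eq_orthogonal (ω : LinearMap.BilinForm K V) (h : ω.IsRefl) (I : Submodule K V) :
    perp ω I = ω.orthogonal I := by
  ext x
  exact forall₂_congr fun y _ => ⟨h x y, h y x⟩

variable [FiniteDimensional K V]

theorem nondegenerate_baseChange {ω : LinearMap.BilinForm K V} (h : ω.Nondegenerate) :
    (ω.baseChange L).Nondegenerate := by
  let b := Module.finBasis K V
  rw [LinearMap.BilinForm.nondegenerate_iff_det_ne_zero (b.baseChange L)]
  have hmat : LinearMap.BilinForm.toMatrix (b.baseChange L) (ω.baseChange L) =
      (LinearMap.BilinForm.toMatrix b ω).map (algebraMap K L) := by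
    ext i j
    simp [LinearMap.BilinForm.toMatrix_apply, Algebra.algebraMap_eq_smul_one]
  rw [hmat, ← RingHom.mapMatrix_apply, ← RingHom.map_det, ne_eq,
    FaithfulSMul.algebraMap_eq_zero_iff]
  exact (LinearMap.BilinForm.nondegenerate_iff_det_ne_zero b).1 h

/-- Base change commutes with taking the perpendicular of a subspace. -/
theorem range_baseChange_perp (ω : LinearMap.BilinForm K V) (halt : ∀ x, ω x x = 0)
    (h : ω.Nondegenerate) (I : Submodule K V) :
    LinearMap.range ((perp ω I).subtype.baseChange L) =
      (ω.baseChange L).orthogonal (LinearMap.range (I.subtype.baseChange L)) := by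
  apply Submodule.eq_of_le_of_finrank_eq
  · rintro _ ⟨x, rfl⟩ _ ⟨y, rfl⟩
    refine baseChange_apply_eq_zero ω (fun a ha b hb => ?_) y x
    rw [skew_of_alt ω halt, hb a ha, neg_zero]
  · rw [LinearMap.BilinForm.finrank_orthogonal (nondegenerate_baseChange h),
      finrank_range_baseChange_subtype, finrank_range_baseChange_subtype,
      Module.finrank_baseChange, perp_eq_orthogonal ω (LinearMap.IsAlt.isRefl halt),
      LinearMap.BilinForm.finrank_orthogonal h]

end Field

/-- For Lagrangian `F` disjoint from `N`, the dimension of `F ∩ N^⊥` is `g - dim N`. -/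
theorem finrank_inf_orthogonal_of_disjoint {K V : Type} [Field K] [AddCommGroup V] [Module K V]
    [FiniteDimensional K V] {g : ℕ} {B : LinearMap.BilinForm K V} (hB : B.Nondegenerate)
    (hV : Module.finrank K V = 2 * g) {F N : Submodule K V}
    (hF : Module.finrank K F = g) (hFiso : ∀ u ∈ F, ∀ v ∈ F, B u v = 0) (hFN : Disjoint F N) :
    Module.finrank K (F ⊓ B.orthogonal N : Submodule K V) = g - Module.finrank K N := by
  have hFF : F = B.orthogonal F := by
    apply Submodule.eq_of_le_of_finrank_eq
    · exact fun u hu v hv => hFiso v hv u hu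
    · rw [LinearMap.BilinForm.finrank_orthogonal hB]
      omega
  have hsup : F ⊓ B.orthogonal N = B.orthogonal (F ⊔ N) := by
    conv_lhs => rw [hFF]
    refine le_antisymm (fun x hx y hy => ?_) (le_inf (LinearMap.BilinForm.orthogonal_le le_sup_left)
      (LinearMap.BilinForm.orthogonal_le le_sup_right))
    obtain ⟨a, ha, b, hb, rfl⟩ := Submodule.mem_sup.1 hy
    have h₁ : B a x = 0 := hx.1 a ha
    have h₂ : B b x = 0 := hx.2 b hb
    rw [map_add, LinearMap.add_apply, h₁, h₂, add_zero]
  have hadd := Submodule.finrank_sup_add_finrank_inf_eq F N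
  rw [hFN.eq_bot, finrank_bot] at hadd
  rw [hsup, LinearMap.BilinForm.finrank_orthogonal hB]
  omega

theorem conjTensor_baseChange {V W : Type} [AddCommGroup V] [Module ℝ V] [AddCommGroup W]
    [Module ℝ W] (f : V →ₗ[ℝ] W) (x : ℂ ⊗[ℝ] V) :
    conjTensor W (f.baseChange ℂ x) = f.baseChange ℂ (conjTensor V x) := by
  induction x with
  | zero => simp
  | add x₁ x₂ h₁ h₂ => simp only [map_add, h₁, h₂]
  | tmul a m => rfl

/-- Let `(V, ω)` be a real symplectic vector space of dimension `2g` and let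
`F ⊆ V_ℂ = ℂ ⊗ V` be a `g`-dimensional complex subspace on which the ℂ-bilinear extension
`ω_ℂ` of `ω` vanishes and with `√−1·ω_ℂ(v, v̄) > 0` for all `0 ≠ v ∈ F`. For an isotropic
real subspace `I ⊆ V`, the image `F'` of `F ∩ (I^⊥)_ℂ` in `(I^⊥/I)_ℂ` is a complex subspace
of dimension `g − dim_ℝ I`, the (complexified) induced form `ω̄` vanishes on `F' × F'`, and
`√−1·ω̄(w, w̄) > 0` for all `0 ≠ w ∈ F'`. -/
theorem boundary_map_of_polarized_subspace
    {V : Type} [AddCommGroup V] [Module ℝ V] [FiniteDimensional ℝ V] (g : ℕ)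
    (ω : V →ₗ[ℝ] V →ₗ[ℝ] ℝ)
    (halt : ∀ x, ω x x = 0)
    (hnondeg : ∀ x, (∀ y, ω x y = 0) → x = 0)
    (hdim : Module.finrank ℝ V = 2 * g)
    (F : Submodule ℂ (ℂ ⊗[ℝ] V))
    (hFdim : Module.finrank ℂ F = g)
    (hFiso : ∀ u ∈ F, ∀ v ∈ F, LinearMap.BilinForm.baseChange ℂ ω u v = 0)
    (hFpos : ∀ v ∈ F, v ≠ 0 →
      (Complex.I * LinearMap.BilinForm.baseChange ℂ ω v (conjTensor V v)).im = 0 ∧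
      0 < (Complex.I * LinearMap.BilinForm.baseChange ℂ ω v (conjTensor V v)).re)
    (I : Submodule ℝ V)
    (hIiso : ∀ x ∈ I, ∀ y ∈ I, ω x y = 0)
    (F' : Submodule ℂ (ℂ ⊗[ℝ] SubQuot ω I))
    (hF' : F' = Submodule.map (LinearMap.baseChange ℂ (perpSub ω I).mkQ)
      (F.comap (LinearMap.baseChange ℂ (perp ω I).subtype))) :
    Module.finrank ℂ F' = g - Module.finrank ℝ I ∧
    (∀ u ∈ F', ∀ v ∈ F',
      LinearMap.BilinForm.baseChange ℂ (inducedForm ω I halt) u v = 0) ∧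
    (∀ w ∈ F', w ≠ 0 →
      (Complex.I * LinearMap.BilinForm.baseChange ℂ (inducedForm ω I halt) w
        (conjTensor (SubQuot ω I) w)).im = 0 ∧
      0 < (Complex.I * LinearMap.BilinForm.baseChange ℂ (inducedForm ω I halt) w
        (conjTensor (SubQuot ω I) w)).re) := by
  have hnd : LinearMap.BilinForm.Nondegenerate ω := .ofSeparatingLeft hnondeg
  have hpos (v) (hv : v ∈ F)
      (h : LinearMap.BilinForm.baseChange ℂ ω v (conjTensor V v) = 0) : v = 0 := by
    by_contra hne
    simpa [h] using (hFpos v hv hne).2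
  have hker (x : ℂ ⊗[ℝ] perp ω I) (hx : (perp ω I).subtype.baseChange ℂ x ∈ F)
      (h : (perpSub ω I).mkQ.baseChange ℂ x = 0) : x = 0 := by
    apply baseChange_subtype_injective (perp ω I)
    rw [map_zero]
    apply hpos _ hx
    rw [conjTensor_baseChange, ← baseChange_inducedForm_mkQ ω I halt, h, map_zero,
      LinearMap.zero_apply]
  subst hF'
  refine ⟨?_, ?_, ?_⟩
  · have hdisj : Disjoint F (LinearMap.range (I.subtype.baseChange ℂ)) := by
      rw [Submodule.disjoint_def]
      rintro _ hF ⟨x, rfl⟩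
      apply hpos _ hF
      rw [conjTensor_baseChange]
      exact baseChange_apply_eq_zero ω hIiso _ _
    have hmap : Module.finrank ℂ (Submodule.map ((perpSub ω I).mkQ.baseChange ℂ)
        (F.comap ((perp ω I).subtype.baseChange ℂ))) =
        Module.finrank ℂ (F.comap ((perp ω I).subtype.baseChange ℂ)) := by
      rw [← LinearMap.range_domRestrict]
      apply LinearMap.finrank_range_of_inj
      rw [injective_iff_map_eq_zero]
      exact fun x hx => Subtype.ext (hker x x.2 hx)
    rw [hmap, (Submodule.equivMapOfInjective _
      (baseChange_subtype_injective (perp ω I)) _).finrank_eq, Submodule.map_comap_eq, range_baseChange_perp ω halt hnd,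
      inf_comm, finrank_inf_orthogonal_of_disjoint (nondegenerate_baseChange hnd)
        (by rw [Module.finrank_baseChange, hdim]) hFdim hFiso hdisj,
      finrank_range_baseChange_subtype]
  · rintro _ ⟨x, hx, rfl⟩ _ ⟨y, hy, rfl⟩
    rw [baseChange_inducedForm_mkQ]
    exact hFiso _ hx _ hy
  · rintro _ ⟨x, hx, rfl⟩ hne
    rw [conjTensor_baseChange, baseChange_inducedForm_mkQ, ← conjTensor_baseChange]
    refine hFpos _ hx fun h => hne ?_
    rw [(map_eq_zero_iff _ (baseChange_subtype_injective _)).1 h, map_zero]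
end
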